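/- arXiv:1807.07507 — 10 statements merged into one kernel-verified Lean document; each statement's English description precedes it below -/
import Mathlib

section
/- Let P ⊆ ℝ^K be a nonempty compact set, let K_P ⊆ ℝ^{K+1} be the conic hull of {(x,1) : x ∈ P}, let A ∈ ℝ^{K×K} be symmetric and b ∈ ℝ^K. Then there exists ρ ∈ ℝ such that the symmetric (K+1)×(K+1) block matrix M = [[−A², −Ab],[−(Ab)ᵀ, ρ − bᵀb]] is strictly copositive with respect to K_P, i.e., vᵀMv > 0 for every v ∈ K_P with v ≠ 0. -/
open Matrix

noncomputable section

/-- The conic hull of `{(x, 1) : x ∈ P}` inside `ℝ^{K+1}`, where the extra (last)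
coordinate is indexed by `Unit`. -/
def liftCone {ι : Type*} (P : Set (ι → ℝ)) : Set ((ι ⊕ Unit) → ℝ) :=
  {v | ∃ (n : ℕ) (lam : Fin n → ℝ) (xs : Fin n → (ι → ℝ)),
    (∀ i, 0 ≤ lam i) ∧ (∀ i, xs i ∈ P) ∧
    v = ∑ i, lam i • (Sum.elim (xs i) (fun _ => (1 : ℝ)))}

/-- The block matrix `[[F, g],[gᵀ, c]]`. -/
def blk2 {ι : Type*} (F : Matrix ι ι ℝ) (g : ι → ℝ) (c : ℝ) :
    Matrix (ι ⊕ Unit) (ι ⊕ Unit) ℝ :=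
  Matrix.fromBlocks F (Matrix.of fun i _ => g i) (Matrix.of fun _ j => g j)
    (Matrix.of fun _ _ => c)

/-- The quadratic form of `[[−A², −Ab],[−(Ab)ᵀ, ρ − bᵀb]]` at `(y, t)` is `ρt² − ‖Ay + tb‖²`. -/
theorem dotProduct_blk2_mulVec {ι : Type*} [Fintype ι] {A : Matrix ι ι ℝ} (hA : A.IsSymm)
    (b y : ι → ℝ) (ρ t : ℝ) :
    Sum.elim y (fun _ => t) ⬝ᵥ
        ((blk2 (-(A * A)) (-(A *ᵥ b)) (ρ - b ⬝ᵥ b)) *ᵥ Sum.elim y (fun _ => t)) =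
      ρ * t ^ 2 - (A *ᵥ y + t • b) ⬝ᵥ (A *ᵥ y + t • b) := by
  have hsymm (u w : ι → ℝ) : u ⬝ᵥ (A *ᵥ w) = (A *ᵥ u) ⬝ᵥ w := by
    rw [dotProduct_mulVec, ← mulVec_transpose, hA.eq]
  have hcol : (Matrix.of fun i (_ : Unit) => (-(A *ᵥ b)) i) *ᵥ (fun _ => t) =
      -(t • (A *ᵥ b)) := by
    ext i
    simp [mulVec, dotProduct, mul_comm]
  have hrow : (Matrix.of fun (_ : Unit) j => (-(A *ᵥ b)) j) *ᵥ y =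
      fun _ => -((A *ᵥ b) ⬝ᵥ y) := by
    ext i
    simp [mulVec, dotProduct]
  have hcorner : (Matrix.of fun (_ _ : Unit) => ρ - b ⬝ᵥ b) *ᵥ (fun _ => t) =
      fun _ => (ρ - b ⬝ᵥ b) * t := by
    ext i
    simp [mulVec, dotProduct]
  rw [blk2, fromBlocks_mulVec, Sum.elim_comp_inl, Sum.elim_comp_inr, hcol, hrow, hcorner,
    sumElim_dotProduct_sumElim]
  have hunit (f g : Unit → ℝ) : f ⬝ᵥ g = f () * g () := by simp [dotProduct]
  rw [hunit]
  have hAb : (A *ᵥ b) ⬝ᵥ y = (A *ᵥ y) ⬝ᵥ b := by rw [← hsymm, dotProduct_comm]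
  simp only [neg_mulVec, ← mulVec_mulVec, dotProduct_add, add_dotProduct, dotProduct_neg,
    dotProduct_smul, smul_dotProduct, smul_eq_mul, Pi.add_apply, hAb, hsymm y,
    dotProduct_comm b (A *ᵥ y)]
  ring

/-- An element of the cone over `P` is `(y, t)` with `t ≥ 0`, and any linear functional satisfying
an affine bound on `P` satisfies its homogenization at `(y, t)`. -/
theorem exists_eq_of_mem_liftCone {ι : Type*} [Fintype ι] {P : Set (ι → ℝ)}
    {v : (ι ⊕ Unit) → ℝ} (hv : v ∈ liftCone P) (hv0 : v ≠ 0) :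
    ∃ (y : ι → ℝ) (t : ℝ), 0 < t ∧ v = Sum.elim y (fun _ => t) ∧
      ∀ (a : ι → ℝ) (β C : ℝ), (∀ x ∈ P, |a ⬝ᵥ x + β| ≤ C) → |a ⬝ᵥ y + t * β| ≤ C * t := by
  obtain ⟨n, lam, xs, hlam, hxs, rfl⟩ := hv
  have ht : 0 ≤ ∑ i, lam i := Finset.sum_nonneg fun i _ => hlam i
  refine ⟨∑ i, lam i • xs i, ∑ i, lam i, lt_of_le_of_ne ht fun h => hv0 ?_, ?_, ?_⟩
  · have hz := (Finset.sum_eq_zero_iff_of_nonneg fun i _ => hlam i).1 h.symm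
    exact Finset.sum_eq_zero fun i hi => by rw [hz i hi, zero_smul]
  · ext (i | i) <;> simp [Finset.sum_apply]
  · intro a β C hC
    have heq : a ⬝ᵥ (∑ i, lam i • xs i) + (∑ i, lam i) * β =
        ∑ i, lam i * (a ⬝ᵥ xs i + β) := by
      simp only [dotProduct_sum, dotProduct_smul, smul_eq_mul, mul_add, Finset.sum_add_distrib,
        Finset.sum_mul]
    rw [heq, Finset.mul_sum]
    refine (Finset.abs_sum_le_sum_abs _ _).trans (Finset.sum_le_sum fun i _ => ?_)
    rw [abs_mul, abs_of_nonneg (hlam i), mul_comm]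
    exact mul_le_mul_of_nonneg_right (hC _ (hxs i)) (hlam i)

/-- For `P ⊆ ℝ^K` nonempty and compact, `A` symmetric and `b ∈ ℝ^K`, there exists `ρ`
such that `[[−A², −Ab],[−(Ab)ᵀ, ρ − bᵀb]]` is strictly copositive w.r.t. the cone
`K_P = cone{(x,1) : x ∈ P}`. -/
theorem stmt_1 {K : ℕ} (P : Set (Fin K → ℝ)) (hP : P.Nonempty) (hPc : IsCompact P)
    (A : Matrix (Fin K) (Fin K) ℝ) (hA : A.IsSymm) (b : Fin K → ℝ) :
    ∃ ρ : ℝ, ∀ v ∈ liftCone P, v ≠ 0 →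
      0 < v ⬝ᵥ ((blk2 (-(A * A)) (-(A *ᵥ b)) (ρ - b ⬝ᵥ b)) *ᵥ v) := by
  obtain ⟨C, hC⟩ : ∃ C, ∀ x ∈ P, ‖A *ᵥ x + b‖ ≤ C :=
    hPc.exists_bound_of_continuousOn (by fun_prop)
  refine ⟨K * C ^ 2 + 1, fun v hv hv0 => ?_⟩
  obtain ⟨y, t, ht, rfl, hbound⟩ := exists_eq_of_mem_liftCone hv hv0
  rw [dotProduct_blk2_mulVec hA]
  have hcoord (j : Fin K) : (A *ᵥ y + t • b) j * (A *ᵥ y + t • b) j ≤ (C * t) ^ 2 := by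
    have h : |(A *ᵥ y + t • b) j| ≤ C * t :=
      hbound (A j) (b j) C fun x hx => (norm_le_pi_norm (A *ᵥ x + b) j).trans (hC x hx)
    rw [← pow_two, ← sq_abs]
    exact pow_le_pow_left₀ (abs_nonneg _) h 2
  have hsum : (A *ᵥ y + t • b) ⬝ᵥ (A *ᵥ y + t • b) ≤ K * (C * t) ^ 2 := by
    simpa [dotProduct] using Finset.sum_le_sum fun j (_ : j ∈ Finset.univ) => hcoord j
  nlinarith [pow_pos ht 2]
end
end

section
/- Let C ⊆ ℝ^n be a nonempty cone (closed under multiplication by nonnegative scalars), let M ∈ ℝ^{n×n} be symmetric, and let A ∈ ℝ^{J×n}. Then vᵀ(M − AᵀA)v ≥ 0 for all v ∈ C if and only if there exists a symmetric positive semidefinite matrix H ∈ ℝ^{n×n} such that vᵀ(M − H)v ≥ 0 for all v ∈ C and the (n+J)×(n+J) block matrix [[H, Aᵀ],[A, I_J]] is positive semidefinite. -/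
open Matrix

noncomputable section

/-- Schur complement criterion for a real block matrix with identity lower-right block. -/
theorem posSemidef_fromBlocks_one_iff {m k : Type*} [Fintype m] [Fintype k] [DecidableEq k]
    (H : Matrix m m ℝ) (A : Matrix k m ℝ) :
    (Matrix.fromBlocks H Aᵀ A (1 : Matrix k k ℝ)).PosSemidef ↔ (H - Aᵀ * A).PosSemidef := by
  let _ : Invertible (1 : Matrix k k ℝ) := invertibleOne
  simpa using Matrix.PosDef.fromBlocks₂₂ H Aᵀ (Matrix.PosDef.one (n := k) (R := ℝ))

/-- Let `C ⊆ ℝ^n` be a nonempty cone, `M` a symmetric matrix, and `A` a `J × n` matrix.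
Then `M − AᵀA` is copositive with respect to `C` if and only if there exists a
positive semidefinite `H` with `M − H` copositive w.r.t. `C` and
`[[H, Aᵀ],[A, I_J]]` positive semidefinite. -/
theorem stmt_2 {n J : ℕ} (C : Set (Fin n → ℝ)) (hC : C.Nonempty)
    (hcone : ∀ v ∈ C, ∀ c : ℝ, 0 ≤ c → c • v ∈ C)
    (M : Matrix (Fin n) (Fin n) ℝ) (hM : M.IsSymm)
    (A : Matrix (Fin J) (Fin n) ℝ) :
    (∀ v ∈ C, 0 ≤ v ⬝ᵥ ((M - Aᵀ * A) *ᵥ v)) ↔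
      ∃ H : Matrix (Fin n) (Fin n) ℝ, H.PosSemidef ∧
        (∀ v ∈ C, 0 ≤ v ⬝ᵥ ((M - H) *ᵥ v)) ∧
        (Matrix.fromBlocks H Aᵀ A (1 : Matrix (Fin J) (Fin J) ℝ)).PosSemidef := by
  constructor
  · intro h
    refine ⟨Aᵀ * A, ?_, h, (posSemidef_fromBlocks_one_iff _ A).2 ?_⟩
    · simpa using Matrix.posSemidef_conjTranspose_mul_self A
    · simpa using Matrix.PosSemidef.zero
  · rintro ⟨H, -, hMH, hblock⟩ v hv
    have hschur := ((posSemidef_fromBlocks_one_iff H A).1 hblock).dotProduct_mulVec_nonneg v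
    have hsum : M - Aᵀ * A = (M - H) + (H - Aᵀ * A) := by abel
    rw [hsum, Matrix.add_mulVec, dotProduct_add]
    exact add_nonneg (hMH v hv) (by simpa using hschur)
end
end

section
/- Let P ⊆ ℝ^K be compact, convex, and have nonempty interior, let K_P ⊆ ℝ^{K+1} be the conic hull of {(x,1) : x ∈ P}, let A ∈ ℝ^{K×K} be symmetric positive definite and b ∈ ℝ^K. Then P ⊆ E(A,b) if and only if there exist a symmetric matrix F ∈ ℝ^{K×K}, a vector g ∈ ℝ^K, and a scalar h ∈ ℝ such that: (i) vᵀ·[[F, g],[gᵀ, h−1]]·v ≤ 0 for all v ∈ K_P, and (ii) the (2K+1)×(2K+1) block matrix [[F, g, A],[gᵀ, h, bᵀ],[A, b, I_K]] is positive semidefinite. -/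
open Matrix

noncomputable section

/-- The ellipsoid `E(A,b) = {x : ‖Ax + b‖² ≤ 1}` (Euclidean norm). -/
def ellipsoid {K : ℕ} (A : Matrix (Fin K) (Fin K) ℝ) (b : Fin K → ℝ) :
    Set (Fin K → ℝ) :=
  {x | (A *ᵥ x + b) ⬝ᵥ (A *ᵥ x + b) ≤ 1}

/-- The block matrix `[[F, g, A],[gᵀ, h, bᵀ],[A, b, I_K]]`. -/
def blk3 {K : ℕ} (F : Matrix (Fin K) (Fin K) ℝ) (g : Fin K → ℝ) (h : ℝ)
    (A : Matrix (Fin K) (Fin K) ℝ) (b : Fin K → ℝ) :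
    Matrix ((Fin K ⊕ Unit) ⊕ Fin K) ((Fin K ⊕ Unit) ⊕ Fin K) ℝ :=
  Matrix.fromBlocks (blk2 F g h)
    (Matrix.of (Sum.elim (fun i j => A i j) (fun _ j => b j)))
    (Matrix.of fun i => Sum.elim (fun j => A i j) (fun _ => b i))
    1

/-- A point of the cone over a nonempty convex set is a nonnegative multiple of a lifted point. -/
theorem exists_smul_of_mem_liftCone {ι : Type*} {P : Set (ι → ℝ)} (hP : Convex ℝ P)
    (hne : P.Nonempty) {v : (ι ⊕ Unit) → ℝ} (hv : v ∈ liftCone P) :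
    ∃ (t : ℝ) (x : ι → ℝ), x ∈ P ∧ v = t • Sum.elim x (fun _ => (1 : ℝ)) := by
  obtain ⟨n, lam, xs, hlam, hxs, rfl⟩ := hv
  rcases (Finset.sum_nonneg fun i _ => hlam i).eq_or_lt' with h0 | hpos
  · obtain ⟨x, hx⟩ := hne
    refine ⟨0, x, hx, ?_⟩
    have hz := (Finset.sum_eq_zero_iff_of_nonneg fun i _ => hlam i).1 h0
    rw [zero_smul]
    exact Finset.sum_eq_zero fun i hi => by rw [hz i hi, zero_smul]
  · refine ⟨∑ i, lam i, Finset.univ.centerMass lam xs,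
      hP.centerMass_mem (fun i _ => hlam i) hpos (fun i _ => hxs i), ?_⟩
    ext (j | j)
    · simp [Finset.centerMass, Finset.sum_apply, mul_inv_cancel_left₀ hpos.ne']
    · simp [Finset.sum_apply]

theorem lift_mem_liftCone {ι : Type*} {P : Set (ι → ℝ)} {x : ι → ℝ} (hx : x ∈ P) :
    Sum.elim x (fun _ => (1 : ℝ)) ∈ liftCone P :=
  ⟨1, fun _ => 1, fun _ => x, fun _ => zero_le_one, fun _ => hx, by simp⟩

theorem dotProduct_blk2_mulVec_lift {ι : Type*} [Fintype ι] (F : Matrix ι ι ℝ) (g : ι → ℝ)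
    (h : ℝ) (x : ι → ℝ) :
    Sum.elim x (fun _ => (1 : ℝ)) ⬝ᵥ (blk2 F g (h - 1) *ᵥ Sum.elim x (fun _ => (1 : ℝ))) =
      Sum.elim x (fun _ => (1 : ℝ)) ⬝ᵥ (blk2 F g h *ᵥ Sum.elim x (fun _ => (1 : ℝ))) - 1 := by
  simp [blk2, dotProduct, mulVec, Fintype.sum_sum_type]
  ring

/-- The off-diagonal block `(A, b)ᵀ` of `blk3`, for symmetric `A`. -/
def affineBlock {K : ℕ} (A : Matrix (Fin K) (Fin K) ℝ) (b : Fin K → ℝ) :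
    Matrix (Fin K ⊕ Unit) (Fin K) ℝ :=
  Matrix.of (Sum.elim (fun i j => A i j) (fun _ j => b j))

/-- Schur complement criterion for `blk3`. -/
theorem blk3_posSemidef_iff {K : ℕ} (F : Matrix (Fin K) (Fin K) ℝ) (g : Fin K → ℝ) (h : ℝ)
    {A : Matrix (Fin K) (Fin K) ℝ} (hA : A.IsSymm) (b : Fin K → ℝ) :
    (blk3 F g h A b).PosSemidef ↔
      (blk2 F g h - affineBlock A b * (affineBlock A b)ᴴ).PosSemidef := by
  have hB : (Matrix.of fun i => Sum.elim (fun j => A i j) (fun _ => b i)) =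
      (affineBlock A b)ᴴ := by
    ext i (j | j)
    · simp [affineBlock, hA.apply]
    · simp [affineBlock]
  rw [blk3, hB]
  change (fromBlocks _ (affineBlock A b) _ _).PosSemidef ↔ _
  have := invertibleOne (α := Matrix (Fin K) (Fin K) ℝ)
  rw [PosDef.fromBlocks₂₂ _ _ PosDef.one, inv_one, Matrix.mul_one]

theorem dotProduct_affineBlock_mulVec_lift {K : ℕ} {A : Matrix (Fin K) (Fin K) ℝ}
    (hA : A.IsSymm) (b x : Fin K → ℝ) :
    Sum.elim x (fun _ => (1 : ℝ)) ⬝ᵥ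
        ((affineBlock A b * (affineBlock A b)ᴴ) *ᵥ Sum.elim x (fun _ => (1 : ℝ))) =
      (A *ᵥ x + b) ⬝ᵥ (A *ᵥ x + b) := by
  have hv : (affineBlock A b)ᵀ *ᵥ Sum.elim x (fun _ => (1 : ℝ)) = A *ᵥ x + b := by
    ext i
    simp [affineBlock, mulVec, dotProduct, Fintype.sum_sum_type, hA.apply]
  rw [conjTranspose_eq_transpose_of_trivial, ← mulVec_mulVec, hv, dotProduct_mulVec,
    ← mulVec_transpose, hv]

theorem affineBlock_mul_conjTranspose {K : ℕ} {A : Matrix (Fin K) (Fin K) ℝ} (b : Fin K → ℝ) :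
    affineBlock A b * (affineBlock A b)ᴴ = blk2 (A * Aᵀ) (A *ᵥ b) (b ⬝ᵥ b) := by
  ext (i | i) (j | j) <;>
    simp [affineBlock, blk2, mul_apply, mulVec, dotProduct, mul_comm]

/-- For `P` compact, convex, with nonempty interior, and `A` symmetric positive definite,
`P ⊆ E(A,b)` iff there exist symmetric `F`, `g`, `h` with `[[F,g],[gᵀ,h−1]]` negative
copositive on the cone `K_P` and `[[F,g,A],[gᵀ,h,bᵀ],[A,b,I]]` positive semidefinite. -/
theorem stmt_3 {K : ℕ} (P : Set (Fin K → ℝ))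
    (hPc : IsCompact P) (hPconv : Convex ℝ P) (hPint : (interior P).Nonempty)
    (A : Matrix (Fin K) (Fin K) ℝ) (hA : A.PosDef) (b : Fin K → ℝ) :
    P ⊆ ellipsoid A b ↔
      ∃ (F : Matrix (Fin K) (Fin K) ℝ) (g : Fin K → ℝ) (h : ℝ), F.IsSymm ∧
        (∀ v ∈ liftCone P, v ⬝ᵥ ((blk2 F g (h - 1)) *ᵥ v) ≤ 0) ∧
        (blk3 F g h A b).PosSemidef := by
  have hAs : A.IsSymm := by
    have := hA.isHermitian
    rwa [IsHermitian, conjTranspose_eq_transpose_of_trivial] at this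
  constructor
  · intro hsub
    refine ⟨A * Aᵀ, A *ᵥ b, b ⬝ᵥ b, isSymm_mul_transpose_self A, fun v hv => ?_, ?_⟩
    · obtain ⟨t, x, hx, rfl⟩ :=
        exists_smul_of_mem_liftCone hPconv (hPint.mono interior_subset) hv
      have hE : (A *ᵥ x + b) ⬝ᵥ (A *ᵥ x + b) ≤ 1 := hsub hx
      rw [mulVec_smul, smul_dotProduct, dotProduct_smul, dotProduct_blk2_mulVec_lift,
        ← affineBlock_mul_conjTranspose, dotProduct_affineBlock_mulVec_lift hAs, smul_eq_mul,
        smul_eq_mul, ← mul_assoc]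
      exact mul_nonpos_of_nonneg_of_nonpos (mul_self_nonneg t) (sub_nonpos.2 hE)
    · rw [blk3_posSemidef_iff _ _ _ hAs, affineBlock_mul_conjTranspose, sub_self]
      exact PosSemidef.zero
  · rintro ⟨F, g, h, -, hcop, hpsd⟩ x hx
    rw [blk3_posSemidef_iff _ _ _ hAs] at hpsd
    have h₁ := hcop _ (lift_mem_liftCone hx)
    have h₂ := hpsd.dotProduct_mulVec_nonneg (Sum.elim x fun _ => (1 : ℝ))
    rw [star_trivial, sub_mulVec, dotProduct_sub, dotProduct_affineBlock_mulVec_lift hAs] at h₂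
    rw [dotProduct_blk2_mulVec_lift] at h₁
    change (A *ᵥ x + b) ⬝ᵥ (A *ᵥ x + b) ≤ 1
    linarith
end
end

section
/- Let K = K₁ + K₂ with K₁, K₂ ≥ 1, let P ⊆ ℝ^K be compact, convex, and have nonempty interior, and let P_x = {x ∈ ℝ^{K₁} : ∃ y ∈ ℝ^{K₂}, (x,y) ∈ P} be the projection of P onto the first K₁ coordinates. Let K_P ⊆ ℝ^{K+1} be the conic hull of {(x,y,1) : (x,y) ∈ P}, let A ∈ ℝ^{K₁×K₁} be symmetric positive definite, b ∈ ℝ^{K₁}, and set Ā = [A 0] ∈ ℝ^{K₁×K}. Then P_x ⊆ E(A,b) if and only if there exist a symmetric F ∈ ℝ^{K×K}, g ∈ ℝ^K, and h ∈ ℝ such that: (i) vᵀ·[[F, g],[gᵀ, h−1]]·v ≤ 0 for all v ∈ K_P, and (ii) the (K+1+K₁)×(K+1+K₁) block matrix [[F, g, Āᵀ],[gᵀ, h, bᵀ],[Ā, b, I_{K₁}]] is positive semidefinite. -/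
open Matrix

noncomputable section

/-- The block matrix `[[F, g, Abᵀ],[gᵀ, h, bᵀ],[Ab, b, I]]` for a rectangular `Ab`. -/
def blk3g {ι κ : Type*} [DecidableEq κ] (F : Matrix ι ι ℝ) (g : ι → ℝ) (h : ℝ)
    (Ab : Matrix κ ι ℝ) (b : κ → ℝ) :
    Matrix ((ι ⊕ Unit) ⊕ κ) ((ι ⊕ Unit) ⊕ κ) ℝ :=
  Matrix.fromBlocks (blk2 F g h)
    (Matrix.of (Sum.elim (fun i j => Ab j i) (fun _ j => b j)))
    (Matrix.of fun i => Sum.elim (fun j => Ab i j) (fun _ => b i))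
    1

/-- `Ā = [A  0] ∈ ℝ^{K₁×(K₁+K₂)}`. -/
def Abar {K₁ K₂ : ℕ} (A : Matrix (Fin K₁) (Fin K₁) ℝ) :
    Matrix (Fin K₁) (Fin K₁ ⊕ Fin K₂) ℝ :=
  Matrix.of fun i => Sum.elim (fun j => A i j) (fun _ => (0 : ℝ))

/-- The affine map `z ↦ Ab z + b`, homogenised to the matrix `[Ab  b]`. -/
def homogMatrix {ι κ : Type*} (Ab : Matrix κ ι ℝ) (b : κ → ℝ) : Matrix κ (ι ⊕ Unit) ℝ :=
  Matrix.of fun i => Sum.elim (Ab i) (fun _ => b i)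

theorem homogMatrix_mulVec {ι κ : Type*} [Fintype ι] (Ab : Matrix κ ι ℝ) (b : κ → ℝ)
    (z : ι → ℝ) :
    homogMatrix Ab b *ᵥ Sum.elim z (fun _ => (1 : ℝ)) = Ab *ᵥ z + b := by
  ext i
  simp [homogMatrix, mulVec, dotProduct]

theorem Abar_mulVec {K₁ K₂ : ℕ} (A : Matrix (Fin K₁) (Fin K₁) ℝ) (x : Fin K₁ → ℝ)
    (y : Fin K₂ → ℝ) : Abar A *ᵥ Sum.elim x y = A *ᵥ x := by
  ext i
  simp [Abar, mulVec, dotProduct]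

theorem dotProduct_blk2_sub_one {ι : Type*} [Fintype ι] (F : Matrix ι ι ℝ) (g : ι → ℝ)
    (h : ℝ) (v : ι ⊕ Unit → ℝ) :
    v ⬝ᵥ (blk2 F g (h - 1) *ᵥ v) = v ⬝ᵥ (blk2 F g h *ᵥ v) - v (Sum.inr ()) ^ 2 := by
  simp [blk2, mulVec, dotProduct]
  ring

theorem blk3g_eq_fromBlocks {ι κ : Type*} [DecidableEq κ] (F : Matrix ι ι ℝ) (g : ι → ℝ)
    (h : ℝ) (Ab : Matrix κ ι ℝ) (b : κ → ℝ) :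
    blk3g F g h Ab b =
      fromBlocks (blk2 F g h) (homogMatrix Ab b)ᵀ (homogMatrix Ab b) 1 := by
  unfold blk3g
  congr 1
  ext (i | i) j <;> simp [homogMatrix]

/-- The Gram matrix of `[Ab  b]` in block form. -/
theorem blk2_gram {ι κ : Type*} [Fintype κ] (Ab : Matrix κ ι ℝ) (b : κ → ℝ) :
    blk2 (Abᵀ * Ab) (Abᵀ *ᵥ b) (b ⬝ᵥ b) = (homogMatrix Ab b)ᵀ * homogMatrix Ab b := by
  ext (i | i) (j | j) <;>
    simp [blk2, homogMatrix, mul_apply, mulVec, dotProduct, mul_comm]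

theorem posSemidef_fromBlocks_gram {ι κ : Type*} [Finite ι] [Fintype κ] [DecidableEq κ]
    (N : Matrix κ ι ℝ) : (fromBlocks (Nᵀ * N) Nᵀ N 1).PosSemidef := by
  convert posSemidef_conjTranspose_mul_self (fromCols N (1 : Matrix κ κ ℝ)) using 1
  simp [conjTranspose_eq_transpose_of_trivial, transpose_fromCols]

theorem dotProduct_mulVec_self_le_of_posSemidef {ι κ : Type*} [Fintype ι] [Fintype κ]
    [DecidableEq κ] {Q : Matrix ι ι ℝ} {N : Matrix κ ι ℝ}
    (hQ : (fromBlocks Q Nᵀ N 1).PosSemidef) (v : ι → ℝ) :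
    (N *ᵥ v) ⬝ᵥ (N *ᵥ v) ≤ v ⬝ᵥ (Q *ᵥ v) := by
  have hv := hQ.dotProduct_mulVec_nonneg (Sum.elim v (-(N *ᵥ v)))
  rw [star_trivial, fromBlocks_mulVec, Sum.elim_comp_inl, Sum.elim_comp_inr,
    sumElim_dotProduct_sumElim, dotProduct_add, mulVec_neg, mulVec_neg, dotProduct_neg,
    dotProduct_mulVec v Nᵀ, vecMul_transpose, one_mulVec, add_neg_cancel, dotProduct_zero] at hv
  linarith

/-- A nonnegative combination of vectors of norm at most one has norm at most the
total weight. -/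
theorem dotProduct_sum_smul_self_le {κ σ : Type*} [Fintype κ] [Fintype σ] {c : σ → ℝ}
    {u : σ → κ → ℝ} (hc : ∀ s, 0 ≤ c s) (hu : ∀ s, u s ⬝ᵥ u s ≤ 1) :
    (∑ s, c s • u s) ⬝ᵥ (∑ s, c s • u s) ≤ (∑ s, c s) ^ 2 := by
  have huv : ∀ s t, u s ⬝ᵥ u t ≤ 1 := fun s t => by
    have h0 : 0 ≤ (u s - u t) ⬝ᵥ (u s - u t) :=
      Finset.sum_nonneg fun i _ => mul_self_nonneg _
    rw [sub_dotProduct, dotProduct_sub, dotProduct_sub, dotProduct_comm (u t) (u s)] at h0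
    linarith [hu s, hu t]
  rw [sq, Finset.sum_mul_sum, sum_dotProduct]
  refine Finset.sum_le_sum fun s _ => ?_
  rw [dotProduct_sum]
  refine Finset.sum_le_sum fun t _ => ?_
  rw [smul_dotProduct, dotProduct_smul, smul_eq_mul, smul_eq_mul, ← mul_assoc]
  exact mul_le_of_le_one_right (mul_nonneg (hc s) (hc t)) (huv s t)

theorem dotProduct_homogMatrix_mulVec_le {ι κ : Type*} [Fintype ι] [Fintype κ]
    {P : Set (ι → ℝ)} {Ab : Matrix κ ι ℝ} {b : κ → ℝ}
    (hP : ∀ z ∈ P, (Ab *ᵥ z + b) ⬝ᵥ (Ab *ᵥ z + b) ≤ 1) {v : ι ⊕ Unit → ℝ}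
    (hv : v ∈ liftCone P) :
    (homogMatrix Ab b *ᵥ v) ⬝ᵥ (homogMatrix Ab b *ᵥ v) ≤ v (Sum.inr ()) ^ 2 := by
  obtain ⟨n, c, z, hc, hz, rfl⟩ := hv
  simp only [mulVec_sum, mulVec_smul, homogMatrix_mulVec]
  simpa using dotProduct_sum_smul_self_le hc fun s => hP _ (hz s)

theorem sumElim_one_mem_liftCone {ι : Type*} {P : Set (ι → ℝ)} {z : ι → ℝ} (hz : z ∈ P) :
    Sum.elim z (fun _ => (1 : ℝ)) ∈ liftCone P :=
  ⟨1, fun _ => 1, fun _ => z, fun _ => zero_le_one, fun _ => hz, by simp⟩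

/-- The containment certificate for an arbitrary set `P` and an affine map `z ↦ Ab z + b`. -/
theorem forall_dotProduct_le_one_iff_exists_certificate {ι κ : Type*} [Fintype ι] [Fintype κ]
    [DecidableEq κ] (P : Set (ι → ℝ)) (Ab : Matrix κ ι ℝ) (b : κ → ℝ) :
    (∀ z ∈ P, (Ab *ᵥ z + b) ⬝ᵥ (Ab *ᵥ z + b) ≤ 1) ↔
      ∃ (F : Matrix ι ι ℝ) (g : ι → ℝ) (h : ℝ), F.IsSymm ∧
        (∀ v ∈ liftCone P, v ⬝ᵥ ((blk2 F g (h - 1)) *ᵥ v) ≤ 0) ∧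
        (blk3g F g h Ab b).PosSemidef := by
  constructor
  · intro hP
    refine ⟨Abᵀ * Ab, Abᵀ *ᵥ b, b ⬝ᵥ b, by simp [IsSymm, transpose_mul], fun v hv => ?_, ?_⟩
    · rw [dotProduct_blk2_sub_one, blk2_gram, ← mulVec_mulVec, dotProduct_mulVec,
        vecMul_transpose, sub_nonpos]
      exact dotProduct_homogMatrix_mulVec_le hP hv
    · rw [blk3g_eq_fromBlocks, blk2_gram]
      exact posSemidef_fromBlocks_gram _
  · rintro ⟨F, g, h, -, hcone, hpsd⟩ z hz
    have hle := hcone _ (sumElim_one_mem_liftCone hz)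
    rw [blk3g_eq_fromBlocks] at hpsd
    have hge := dotProduct_mulVec_self_le_of_posSemidef hpsd (Sum.elim z fun _ => 1)
    rw [homogMatrix_mulVec] at hge
    rw [dotProduct_blk2_sub_one, Sum.elim_inr] at hle
    linarith

/-- Projection of the generalized copositive containment certificate:
for `P ⊆ ℝ^{K₁+K₂}` compact, convex, with nonempty interior, and `A ∈ ℝ^{K₁×K₁}`
symmetric positive definite, the projection `P_x` of `P` onto the first `K₁`
coordinates is contained in `E(A,b)` iff the conic certificate with `Ā = [A 0]` exists. -/
theorem stmt_4 {K₁ K₂ : ℕ} (hK₁ : 1 ≤ K₁) (hK₂ : 1 ≤ K₂)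
    (P : Set ((Fin K₁ ⊕ Fin K₂) → ℝ))
    (hPc : IsCompact P) (hPconv : Convex ℝ P) (hPint : (interior P).Nonempty)
    (A : Matrix (Fin K₁) (Fin K₁) ℝ) (hA : A.PosDef) (b : Fin K₁ → ℝ) :
    {x : Fin K₁ → ℝ | ∃ y : Fin K₂ → ℝ, Sum.elim x y ∈ P} ⊆ ellipsoid A b ↔
      ∃ (F : Matrix (Fin K₁ ⊕ Fin K₂) (Fin K₁ ⊕ Fin K₂) ℝ)
        (g : (Fin K₁ ⊕ Fin K₂) → ℝ) (h : ℝ), F.IsSymm ∧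
        (∀ v ∈ liftCone P, v ⬝ᵥ ((blk2 F g (h - 1)) *ᵥ v) ≤ 0) ∧
        (blk3g F g h (Abar A) b).PosSemidef := by
  rw [← forall_dotProduct_le_one_iff_exists_certificate]
  constructor
  · intro hsub z hz
    rw [← Sum.elim_comp_inl_inr z] at hz ⊢
    rw [Abar_mulVec]
    exact hsub ⟨_, hz⟩
  · rintro hP x ⟨y, hxy⟩
    have := hP _ hxy
    rwa [Abar_mulVec] at this
end
end

section
/- Let P = {x ∈ ℝ^K : Sx ≤ t} (with S ∈ ℝ^{J×K}, t ∈ ℝ^J, inequality entrywise) be a polytope that is compact, convex, and has nonempty interior, let A ∈ ℝ^{K×K} be symmetric positive definite and b ∈ ℝ^K. Suppose there exist a matrix N ∈ ℝ^{J×J} with all entries nonnegative, a symmetric F ∈ ℝ^{K×K}, g ∈ ℝ^K, and h ∈ ℝ such that: (i) [[F, g],[gᵀ, h−1]] ⪯ −𝒮ᵀN𝒮 in the Loewner order, where 𝒮 = [−S t] ∈ ℝ^{J×(K+1)}, and (ii) the block matrix [[F, g, A],[gᵀ, h, bᵀ],[A, b, I_K]] is positive semidefinite. Then P ⊆ E(A,b).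 -/
open Matrix

noncomputable section

/-- `𝒮 = [−S  t]`. -/
def calS {ι : Type*} {K : ℕ} (S : Matrix ι (Fin K) ℝ) (t : ι → ℝ) :
    Matrix ι (Fin K ⊕ Unit) ℝ :=
  Matrix.of fun j => Sum.elim (fun k => -S j k) (fun _ => t j)

/-- The quadratic form of `[[F, g],[gᵀ, c]]` at `(x, 1)` is affine in the corner entry `c`. -/
lemma dotProduct_blk2_mulVec_s7 {K : ℕ} (F : Matrix (Fin K) (Fin K) ℝ) (g x : Fin K → ℝ) (c : ℝ) :
    Sum.elim x (fun _ => 1) ⬝ᵥ (blk2 F g c *ᵥ Sum.elim x (fun _ => 1)) =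
      x ⬝ᵥ (F *ᵥ x) + 2 * (g ⬝ᵥ x) + c := by
  have h1 : (Matrix.of fun i (_ : Unit) => g i) *ᵥ (fun _ => (1 : ℝ)) = g := by
    ext i
    simp [mulVec, dotProduct]
  have h2 : (Matrix.of fun (_ : Unit) j => g j) *ᵥ x = fun _ => g ⬝ᵥ x := by
    ext i
    simp [mulVec]
  have h3 : (Matrix.of fun (_ : Unit) (_ : Unit) => c) *ᵥ (fun _ => (1 : ℝ)) = fun _ => c := by
    ext i
    simp [mulVec, dotProduct]
  rw [blk2, fromBlocks_mulVec, sumElim_dotProduct_sumElim]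
  simp only [Sum.elim_comp_inl, Sum.elim_comp_inr, h1, h2, h3, dotProduct_add,
    dotProduct_comm x g]
  simp only [dotProduct, Finset.univ_unique, Finset.sum_singleton]
  ring

/-- The matrix `[−S  t]` maps `(x, 1)` to the slack vector `t − Sx`. -/
lemma calS_mulVec {ι : Type*} {K : ℕ} (S : Matrix ι (Fin K) ℝ) (t : ι → ℝ) (x : Fin K → ℝ) :
    calS S t *ᵥ Sum.elim x (fun _ => 1) = t - S *ᵥ x := by
  ext j
  simp [calS, mulVec, dotProduct, sub_eq_add_neg, add_comm]

/-- For symmetric `A`, the quadratic form of `blk3 F g h A b` at `(x, 1, -(Ax + b))`. -/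
lemma dotProduct_blk3_mulVec {K : ℕ} (F : Matrix (Fin K) (Fin K) ℝ) (g : Fin K → ℝ) (h : ℝ)
    {A : Matrix (Fin K) (Fin K) ℝ} (hA : A.IsSymm) (b x : Fin K → ℝ) :
    Sum.elim (Sum.elim x (fun _ => 1)) (-(A *ᵥ x + b)) ⬝ᵥ
        (blk3 F g h A b *ᵥ Sum.elim (Sum.elim x (fun _ => 1)) (-(A *ᵥ x + b))) =
      x ⬝ᵥ (F *ᵥ x) + 2 * (g ⬝ᵥ x) + h - (A *ᵥ x + b) ⬝ᵥ (A *ᵥ x + b) := by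
  have h1 : (Matrix.of fun i => Sum.elim (fun j => A i j) (fun (_ : Unit) => b i)) *ᵥ
      Sum.elim x (fun _ => 1) = A *ᵥ x + b := by
    ext i
    simp [mulVec, dotProduct]
  have h2 : (Matrix.of (Sum.elim (fun i j => A i j) (fun (_ : Unit) j => b j))) =
      (Matrix.of fun i => Sum.elim (fun j => A i j) (fun (_ : Unit) => b i))ᵀ := by
    ext (i | i) j
    · simp [hA.apply j i]
    · simp
  rw [blk3, fromBlocks_mulVec, sumElim_dotProduct_sumElim]
  simp only [Sum.elim_comp_inl, Sum.elim_comp_inr, h2, dotProduct_add, dotProduct_blk2_mulVec_s7]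
  rw [dotProduct_mulVec _ (_ᵀ), vecMul_transpose, h1, one_mulVec]
  simp only [dotProduct_neg, neg_dotProduct, dotProduct_add]
  ring

/-- Sufficient SDP conditions for a polytope `P = {x : Sx ≤ t}` to be contained in the
ellipsoid `E(A,b)`. -/
theorem stmt_7 {K J : ℕ} (S : Matrix (Fin J) (Fin K) ℝ) (t : Fin J → ℝ)
    (hPc : IsCompact {x : Fin K → ℝ | S *ᵥ x ≤ t})
    (hPconv : Convex ℝ {x : Fin K → ℝ | S *ᵥ x ≤ t})
    (hPint : (interior {x : Fin K → ℝ | S *ᵥ x ≤ t}).Nonempty)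
    (A : Matrix (Fin K) (Fin K) ℝ) (hA : A.PosDef) (b : Fin K → ℝ)
    (N : Matrix (Fin J) (Fin J) ℝ) (hN : ∀ i j, 0 ≤ N i j)
    (F : Matrix (Fin K) (Fin K) ℝ) (hF : F.IsSymm) (g : Fin K → ℝ) (h : ℝ)
    (h1 : (-((calS S t)ᵀ * N * calS S t) - blk2 F g (h - 1)).PosSemidef)
    (h2 : (blk3 F g h A b).PosSemidef) :
    {x : Fin K → ℝ | S *ᵥ x ≤ t} ⊆ ellipsoid A b := by
  intro x hx
  have hw : 0 ≤ t - S *ᵥ x := sub_nonneg.mpr hx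
  have hNw : 0 ≤ (t - S *ᵥ x) ⬝ᵥ (N *ᵥ (t - S *ᵥ x)) :=
    dotProduct_nonneg_of_nonneg hw fun i => dotProduct_nonneg_of_nonneg (hN i) hw
  have hq := h1.dotProduct_mulVec_nonneg (Sum.elim x (fun _ => 1))
  rw [star_trivial, sub_mulVec, neg_mulVec, dotProduct_sub, dotProduct_neg,
    dotProduct_blk2_mulVec_s7, ← mulVec_mulVec, ← mulVec_mulVec, dotProduct_mulVec _ (_ᵀ),
    vecMul_transpose, calS_mulVec] at hq
  have hy := h2.dotProduct_mulVec_nonneg (Sum.elim (Sum.elim x (fun _ => 1)) (-(A *ᵥ x + b)))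
  have hAs : A.IsSymm := by simpa [IsHermitian, IsSymm] using hA.isHermitian
  rw [star_trivial, dotProduct_blk3_mulVec F g h hAs] at hy
  change (A *ᵥ x + b) ⬝ᵥ (A *ᵥ x + b) ≤ 1
  linarith
end
end

section
/- Let P = {x ∈ ℝ^K : Sx ≤ t} (with S ∈ ℝ^{J×K}, t ∈ ℝ^J) be a nonempty polytope. Let Λ ∈ ℝ^{J×K} and ρ ∈ ℝ^J satisfy Sᵀρ = 0, ‖Λ_{j:}‖ ≤ ρ_j for every j ∈ {1,…,J} (where Λ_{j:} ∈ ℝ^K is the j-th row of Λ and ‖·‖ the Euclidean norm), and suppose SᵀΛ + ΛᵀS is positive definite. Then there exist a symmetric positive definite A ∈ ℝ^{K×K}, b ∈ ℝ^K, and an entrywise nonnegative N ∈ ℝ^{J×J} such that [[A², Ab],[(Ab)ᵀ, bᵀb]] ⪯ [[0, 0],[0, 1]] − 𝒮ᵀN𝒮 in the Loewner order (where 𝒮 = [−S t] ∈ ℝ^{J×(K+1)}), and −log det A ≤ K·(tᵀρ) − K − log det( (1/2)(SᵀΛ + ΛᵀS) ). -/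
open Matrix

noncomputable section

open scoped MatrixOrder

/-- Polar decomposition of an invertible real matrix. -/
theorem exists_polar_decomposition {n : Type*} [Fintype n] [DecidableEq n] {M : Matrix n n ℝ}
    (hM : IsUnit M) :
    ∃ U A : Matrix n n ℝ, A.PosDef ∧ Uᵀ * U = 1 ∧ U * Uᵀ = 1 ∧ M = U * A := by
  have hQ : (Mᵀ * M).PosDef := by
    rw [← conjTranspose_eq_transpose_of_trivial]
    exact PosDef.conjTranspose_mul_self M (mulVec_injective_iff_isUnit.2 hM)
  have hA : (CFC.sqrt (Mᵀ * M)).PosDef :=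
    hQ.isStrictlyPositive.sqrt.posDef
  have hAA : CFC.sqrt (Mᵀ * M) * CFC.sqrt (Mᵀ * M) = Mᵀ * M :=
    CFC.sqrt_mul_sqrt_self _ hQ.posSemidef.nonneg
  set A := CFC.sqrt (Mᵀ * M)
  have hdet : IsUnit A.det := (isUnit_iff_isUnit_det A).1 hA.isUnit
  have hAt : A⁻¹ᵀ = A⁻¹ := by
    simpa [conjTranspose_eq_transpose_of_trivial] using hA.inv.isHermitian.eq
  have hU : (M * A⁻¹)ᵀ * (M * A⁻¹) = 1 := by
    rw [transpose_mul, hAt, Matrix.mul_assoc, ← Matrix.mul_assoc Mᵀ, ← hAA, Matrix.mul_assoc,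
      mul_nonsing_inv _ hdet, Matrix.mul_one, nonsing_inv_mul _ hdet]
  exact ⟨M * A⁻¹, A, hA, hU, mul_eq_one_comm.1 hU, (nonsing_inv_mul_cancel_right _ _ hdet).symm⟩

theorem Matrix.PosSemidef.one_le_det_one_add {n : Type*} [Fintype n] [DecidableEq n]
    {P : Matrix n n ℝ} (hP : P.PosSemidef) : 1 ≤ (1 + P).det := by
  have hB : (1 + P).IsHermitian := isHermitian_one.add hP.isHermitian
  rw [hB.det_eq_prod_eigenvalues]
  refine Finset.one_le_prod fun i _ => ?_
  have hev := hB.mulVec_eigenvectorBasis i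
  have hnn := hP.dotProduct_mulVec_nonneg (hB.eigenvectorBasis i).ofLp
  have hv : (hB.eigenvectorBasis i).ofLp ≠ 0 := by
    simpa using hB.eigenvectorBasis.toBasis.ne_zero i
  set v := (hB.eigenvectorBasis i).ofLp
  have hpos : 0 < v ⬝ᵥ v := by simpa using dotProduct_star_self_pos_iff.2 hv
  have h := congrArg (v ⬝ᵥ ·) hev
  simp only [add_mulVec, one_mulVec, dotProduct_add, dotProduct_smul, smul_eq_mul] at h
  simp only [star_trivial] at hnn
  simp only [RCLike.ofReal_real_eq_id, id]
  nlinarith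

theorem Matrix.PosDef.det_le_det_add {n : Type*} [Fintype n] [DecidableEq n]
    {H P : Matrix n n ℝ} (hH : H.PosDef) (hP : P.PosSemidef) : H.det ≤ (H + P).det := by
  have hR : (CFC.sqrt H).PosDef := hH.isStrictlyPositive.sqrt.posDef
  have hRR : CFC.sqrt H * CFC.sqrt H = H := CFC.sqrt_mul_sqrt_self _ hH.posSemidef.nonneg
  set R := CFC.sqrt H
  have hdet : IsUnit R.det := (isUnit_iff_isUnit_det R).1 hR.isUnit
  have hQ : (R⁻¹ * P * R⁻¹).PosSemidef := by
    have h := hP.conjTranspose_mul_mul_same R⁻¹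
    rwa [hR.inv.isHermitian.eq] at h
  have hfac : H + P = R * (1 + R⁻¹ * P * R⁻¹) * R := by
    rw [Matrix.mul_add, Matrix.add_mul, Matrix.mul_one, hRR, Matrix.mul_assoc R⁻¹,
      mul_nonsing_inv_cancel_left _ _ hdet, nonsing_inv_mul_cancel_right _ _ hdet]
  have hHdet : H.det = R.det * R.det := by rw [← det_mul, hRR]
  rw [hfac, det_mul, det_mul, hHdet]
  nlinarith [hQ.one_le_det_one_add, mul_pos hR.det_pos hR.det_pos]

/-- The Ostrowski–Taussky inequality. -/
theorem det_half_add_transpose_le_abs_det {n : Type*} [Fintype n] [DecidableEq n]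
    {M : Matrix n n ℝ} (hH : ((1 / 2 : ℝ) • (Mᵀ + M)).PosDef) :
    ((1 / 2 : ℝ) • (Mᵀ + M)).det ≤ |M.det| := by
  set H := (1 / 2 : ℝ) • (Mᵀ + M) with hHdef
  set W := (1 / 2 : ℝ) • (M - Mᵀ) with hW
  have hdet : IsUnit H.det := (isUnit_iff_isUnit_det H).1 hH.isUnit
  have hM : M = H + W := by
    rw [hHdef, hW]; module
  have hMt : Mᵀ = H - W := by
    rw [hHdef, hW]; module
  have hWt : Wᵀ = -W := by
    simp only [hW, transpose_smul, transpose_sub, transpose_transpose]; module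
  have hP : (Wᵀ * H⁻¹ * W).PosSemidef := by
    simpa [conjTranspose_eq_transpose_of_trivial] using
      hH.inv.posSemidef.conjTranspose_mul_mul_same W
  have hprod : H + Wᵀ * H⁻¹ * W = Mᵀ * H⁻¹ * M := by
    rw [hMt, hWt, hM]
    simp only [Matrix.mul_add, Matrix.sub_mul, Matrix.neg_mul,
      mul_nonsing_inv _ hdet, Matrix.one_mul, nonsing_inv_mul_cancel_right _ _ hdet]
    abel
  have hle := hH.det_le_det_add hP
  rw [hprod, det_mul, det_mul, det_transpose, det_nonsing_inv, Ring.inverse_eq_inv'] at hle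
  have hpos := hH.det_pos
  refine le_of_sq_le_sq ?_ (abs_nonneg _)
  rw [sq_abs]
  calc H.det ^ 2 = H.det * H.det := sq _
    _ ≤ (M.det * H.det⁻¹ * M.det) * H.det := by gcongr
    _ = M.det ^ 2 := by field_simp

/-- Bounding Gram matrices entrywise by the product of bounds on the row norms. -/
theorem dotProduct_le_mul_of_sqrt_le {n : Type*} [Fintype n] {u v : n → ℝ} {a b : ℝ}
    (hu : Real.sqrt (u ⬝ᵥ u) ≤ a) (hv : Real.sqrt (v ⬝ᵥ v) ≤ b) : u ⬝ᵥ v ≤ a * b := by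
  calc u ⬝ᵥ v ≤ Real.sqrt (u ⬝ᵥ u) * Real.sqrt (v ⬝ᵥ v) := by
        simpa [dotProduct, sq] using Real.sum_mul_le_sqrt_mul_sqrt Finset.univ u v
    _ ≤ a * b := by gcongr; exact (Real.sqrt_nonneg _).trans hu

theorem blk2_zero_posSemidef {ι : Type*} [Fintype ι] {c : ℝ} (hc : 0 ≤ c) :
    (blk2 (0 : Matrix ι ι ℝ) 0 c).PosSemidef := by
  classical
  have h : blk2 (0 : Matrix ι ι ℝ) 0 c = diagonal (Sum.elim 0 fun _ => c) := by
    ext (i | i) (j | j) <;> simp [blk2, diagonal_apply]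
  rw [h, posSemidef_diagonal_iff]
  rintro (i | i) <;> simp [hc]

theorem blk2_sub_calS_sub_blk2_eq {ι : Type*} [Fintype ι] {K : ℕ} {S L : Matrix ι (Fin K) ℝ}
    {t r : ι → ℝ} {U A : Matrix (Fin K) (Fin K) ℝ} (hr : Sᵀ *ᵥ r = 0) (hA : Aᵀ = A)
    (hU : Uᵀ * U = 1) (hU' : U * Uᵀ = 1) (hUA : Lᵀ * S = U * A) :
    blk2 (0 : Matrix (Fin K) (Fin K) ℝ) 0 1
        - (calS S t)ᵀ * (vecMulVec r r - L * Lᵀ) * calS S t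
        - blk2 (A * A) (A *ᵥ -(Uᵀ *ᵥ (Lᵀ *ᵥ t))) (-(Uᵀ *ᵥ (Lᵀ *ᵥ t)) ⬝ᵥ -(Uᵀ *ᵥ (Lᵀ *ᵥ t))) =
      blk2 (0 : Matrix (Fin K) (Fin K) ℝ) 0 (1 - (t ⬝ᵥ r) ^ 2) := by
  set w := Uᵀ *ᵥ (Lᵀ *ᵥ t) with hw
  have hdot (u v : Fin K → ℝ) : (U *ᵥ u) ⬝ᵥ (U *ᵥ v) = u ⬝ᵥ v := by
    rw [dotProduct_mulVec, vecMul_mulVec, hU, vecMul_one]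
  have hentry (p q : Fin K ⊕ Unit) :
      ((calS S t)ᵀ * (vecMulVec r r - L * Lᵀ) * calS S t) p q =
        ((calS S t).col p ⬝ᵥ r) * ((calS S t).col q ⬝ᵥ r) -
          (Lᵀ *ᵥ (calS S t).col p) ⬝ᵥ (Lᵀ *ᵥ (calS S t).col q) := by
    have h1 : (calS S t)ᵀ * (vecMulVec r r - L * Lᵀ) * calS S t =
        vecMulVec ((calS S t)ᵀ *ᵥ r) ((calS S t)ᵀ *ᵥ r) -
          (Lᵀ * calS S t)ᵀ * (Lᵀ * calS S t) := by
      rw [Matrix.mul_sub, Matrix.sub_mul, mul_vecMulVec, vecMulVec_mul, ← mulVec_transpose,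
        transpose_mul, transpose_transpose]
      simp only [Matrix.mul_assoc]
    rw [h1]
    rfl
  have hcol (k : Fin K) : (calS S t).col (Sum.inl k) = -S.col k := rfl
  have hcol' (u : Unit) : (calS S t).col (Sum.inr u) = t := rfl
  have hSr (k : Fin K) : S.col k ⬝ᵥ r = 0 := congrFun hr k
  have hLS (k : Fin K) : Lᵀ *ᵥ S.col k = U *ᵥ A.col k := by
    ext i
    exact congrFun (congrFun hUA i) k
  have hLt : Lᵀ *ᵥ t = U *ᵥ w := by rw [hw, mulVec_mulVec, hU', one_mulVec]
  have hAsymm (i j : Fin K) : A i j = A j i := congrFun (congrFun hA j) i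
  ext (i | i) (j | j) <;>
    simp only [Matrix.sub_apply, hentry, hcol, hcol', mulVec_neg, hLS, hLt, neg_dotProduct,
      dotProduct_neg, hSr, hdot] <;>
    simp [blk2, mul_apply, mulVec, dotProduct, hAsymm, mul_comm, sq]
  ring

/-- From a dual feasible solution `(Λ, ρ)` of the scaled-MVIE problem one can construct
a feasible solution `(A, b, N)` of the copositive-based SDP with objective value at
least as good. -/
theorem stmt_8 {K J : ℕ} (S : Matrix (Fin J) (Fin K) ℝ) (t : Fin J → ℝ)
    (hP : ({x : Fin K → ℝ | S *ᵥ x ≤ t}).Nonempty)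
    (Λ : Matrix (Fin J) (Fin K) ℝ) (ρ : Fin J → ℝ)
    (hρ : Sᵀ *ᵥ ρ = 0)
    (hΛ : ∀ j, Real.sqrt (Λ j ⬝ᵥ Λ j) ≤ ρ j)
    (hpd : (Sᵀ * Λ + Λᵀ * S).PosDef) :
    ∃ (A : Matrix (Fin K) (Fin K) ℝ) (b : Fin K → ℝ) (N : Matrix (Fin J) (Fin J) ℝ),
      A.PosDef ∧ (∀ i j, 0 ≤ N i j) ∧
      (blk2 (0 : Matrix (Fin K) (Fin K) ℝ) (0 : Fin K → ℝ) 1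
        - (calS S t)ᵀ * N * calS S t
        - blk2 (A * A) (A *ᵥ b) (b ⬝ᵥ b)).PosSemidef ∧
      -Real.log A.det ≤
        (K : ℝ) * (t ⬝ᵥ ρ) - (K : ℝ)
          - Real.log (((1/2 : ℝ) • (Sᵀ * Λ + Λᵀ * S)).det) := by
  obtain ⟨x, hx⟩ := hP
  have hρ0 : 0 ≤ ρ := fun j => (Real.sqrt_nonneg _).trans (hΛ j)
  have hτ : 0 ≤ t ⬝ᵥ ρ := by
    have h0 : (S *ᵥ x) ⬝ᵥ ρ = 0 := by
      rw [dotProduct_comm, dotProduct_mulVec, ← mulVec_transpose, hρ, zero_dotProduct]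
    rw [← h0]
    exact dotProduct_le_dotProduct_of_nonneg_right hx hρ0
  set τ := t ⬝ᵥ ρ
  -- `c τ ≤ 1`, while `-K log c` is exactly `K τ - K`
  set c := Real.exp (1 - τ) with hc
  have hc0 : 0 < c := Real.exp_pos _
  have hcτ : c * τ ≤ 1 := by
    have h := Real.add_one_le_exp (τ - 1)
    calc c * τ ≤ c * Real.exp (τ - 1) := by gcongr; linarith
      _ = 1 := by rw [hc, ← Real.exp_add]; simp
  have hH : ((1 / 2 : ℝ) • ((Λᵀ * S)ᵀ + Λᵀ * S)).PosDef := by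
    rw [transpose_mul, transpose_transpose]
    exact hpd.smul (by norm_num)
  have hdet := det_half_add_transpose_le_abs_det hH
  have hdet_ne : (Λᵀ * S).det ≠ 0 := abs_pos.1 (hH.det_pos.trans_le hdet)
  have hM : IsUnit ((c • Λ)ᵀ * S) := by
    rw [isUnit_iff_isUnit_det, transpose_smul, Matrix.smul_mul, det_smul, isUnit_iff_ne_zero]
    positivity
  obtain ⟨U, A, hA, hU, hU', hUA⟩ := exists_polar_decomposition hM
  refine ⟨A, -(Uᵀ *ᵥ ((c • Λ)ᵀ *ᵥ t)), vecMulVec (c • ρ) (c • ρ) - (c • Λ) * (c • Λ)ᵀ, hA,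
    fun i j => ?_, ?_, ?_⟩
  · have h := dotProduct_le_mul_of_sqrt_le (hΛ i) (hΛ j)
    have hij : ((c • Λ) * (c • Λ)ᵀ) i j = c ^ 2 * (Λ i ⬝ᵥ Λ j) := by
      simp only [mul_apply, transpose_apply, dotProduct, Finset.mul_sum]
      exact Finset.sum_congr rfl fun _ _ => by
        simp only [Matrix.smul_apply, smul_eq_mul]; ring
    rw [Matrix.sub_apply, hij, vecMulVec_apply]
    simp only [Pi.smul_apply, smul_eq_mul]
    nlinarith [mul_le_mul_of_nonneg_left h (sq_nonneg c)]
  · rw [blk2_sub_calS_sub_blk2_eq (by rw [mulVec_smul, hρ, smul_zero])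
      (by simpa [conjTranspose_eq_transpose_of_trivial] using hA.isHermitian.eq) hU hU' hUA]
    refine blk2_zero_posSemidef ?_
    rw [dotProduct_smul, smul_eq_mul]
    nlinarith [mul_nonneg hc0.le hτ]
  · have hAdet : A.det = c ^ K * |(Λᵀ * S).det| := by
      have h1 : |U.det| = 1 := by
        have h := congrArg det hU
        rw [det_mul, det_transpose, det_one] at h
        rwa [← sq_eq_sq₀ (abs_nonneg _) zero_le_one, sq_abs, one_pow, sq]
      have h2 := congrArg (fun X => |det X|) hUA
      simp only [transpose_smul, Matrix.smul_mul, det_smul, det_mul, abs_mul, h1, one_mul,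
        abs_of_pos hA.det_pos, Fintype.card_fin, abs_of_pos (pow_pos hc0 K)] at h2
      exact h2.symm
    have hlog := Real.log_le_log hH.det_pos hdet
    rw [transpose_mul, transpose_transpose] at hlog
    rw [hAdet, Real.log_mul (by positivity) (by positivity), Real.log_pow, hc, Real.log_exp]
    linarith
end
end

section
/- Let P = {x ∈ ℝ^K : Sx ≤ t} (with S ∈ ℝ^{J×K}, t ∈ ℝ^J) be a polytope that is compact, convex, and has nonempty interior. Suppose (A*, b*, N*) maximizes det A over all triples (A, b, N) with A ∈ ℝ^{K×K} symmetric positive definite, b ∈ ℝ^K, N ∈ ℝ^{J×J} entrywise nonnegative satisfying [[A², Ab],[(Ab)ᵀ, bᵀb]] ⪯ [[0, 0],[0, 1]] − 𝒮ᵀN𝒮 in the Loewner order, where 𝒮 = [−S t] ∈ ℝ^{J×(K+1)}. Suppose also that (B*, d*) maximizes det B over all pairs (B, d) with B ∈ ℝ^{K×K} symmetric positive definite and d ∈ ℝ^K satisfying ‖B·S_{j:}‖ + K·(S_{j:}ᵀ d) ≤ K·t_j for every j ∈ {1,…,J}, where S_{j:} ∈ ℝ^K denotes the transpose of the j-th row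 of S. Then 1/det(A*) ≤ det(B*); that is, the volume of the ellipsoid produced by the copositive-based SDP never exceeds the volume of the scaled maximum-volume inscribed ellipsoid. -/
open Matrix

noncomputable section

/-- Feasibility for the copositive-based SDP approximation of the MVEP:
`A` symmetric positive definite, `N` entrywise nonnegative, and
`[[A², Ab],[(Ab)ᵀ, bᵀb]] ⪯ [[0,0],[0,1]] − 𝒮ᵀN𝒮` in the Loewner order. -/
def copFeasible {K J : ℕ} (S : Matrix (Fin J) (Fin K) ℝ) (t : Fin J → ℝ)
    (A : Matrix (Fin K) (Fin K) ℝ) (b : Fin K → ℝ)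
    (N : Matrix (Fin J) (Fin J) ℝ) : Prop :=
  A.PosDef ∧ (∀ i j, 0 ≤ N i j) ∧
    (blk2 (0 : Matrix (Fin K) (Fin K) ℝ) (0 : Fin K → ℝ) 1
      - (calS S t)ᵀ * N * calS S t
      - blk2 (A * A) (A *ᵥ b) (b ⬝ᵥ b)).PosSemidef

/-- Feasibility for the scaled maximum-volume inscribed ellipsoid problem:
`B` symmetric positive definite and `‖B S_{j:}‖ + K (S_{j:}ᵀ d) ≤ K t_j` for all `j`. -/
def insFeasible {K J : ℕ} (S : Matrix (Fin J) (Fin K) ℝ) (t : Fin J → ℝ)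
    (B : Matrix (Fin K) (Fin K) ℝ) (d : Fin K → ℝ) : Prop :=
  B.PosDef ∧ ∀ j, Real.sqrt ((B *ᵥ S j) ⬝ᵥ (B *ᵥ S j)) + (K : ℝ) * (S j ⬝ᵥ d) ≤ (K : ℝ) * t j

open Filter Topology in
/-- Along a direction pointing strictly inwards to first order, a cone constraint is preserved. -/
lemma eventually_sqrt_dotProduct_add_smul_le {n : Type*} [Fintype n] (w g : n → ℝ) (τ β : ℝ)
    (hw : w ≠ 0) (hle : √(w ⬝ᵥ w) ≤ τ) (hact : √(w ⬝ᵥ w) = τ → w ⬝ᵥ g + τ * β < 0) :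
    ∀ᶠ ε : ℝ in 𝓝[>] 0, √((w + ε • g) ⬝ᵥ (w + ε • g)) + ε * β ≤ τ := by
  have hww : 0 < w ⬝ᵥ w := by
    simpa using dotProduct_star_self_pos_iff.2 hw
  have hτ : 0 < τ := (Real.sqrt_pos.2 hww).trans_le hle
  have key : ∀ᶠ ε : ℝ in 𝓝[>] 0, (w + ε • g) ⬝ᵥ (w + ε • g) ≤ (τ - ε * β) ^ 2 := by
    have expand (ε : ℝ) : (w + ε • g) ⬝ᵥ (w + ε • g)
        = w ⬝ᵥ w + ε * (2 * (w ⬝ᵥ g) + ε * (g ⬝ᵥ g)) := by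
      simp [dotProduct_add, add_dotProduct, dotProduct_comm g w]; ring
    simp only [expand]
    rcases hle.lt_or_eq with hlt | heq
    · have hlt' : w ⬝ᵥ w < τ ^ 2 := (Real.sqrt_lt' hτ).1 hlt
      apply nhdsWithin_le_nhds
      have := ContinuousAt.eventually_lt (x₀ := (0 : ℝ))
        (f := fun ε => w ⬝ᵥ w + ε * (2 * (w ⬝ᵥ g) + ε * (g ⬝ᵥ g)))
        (g := fun ε => (τ - ε * β) ^ 2) (by fun_prop) (by fun_prop) (by simpa using hlt')
      exact this.mono fun ε h => h.le
    · have hsq : w ⬝ᵥ w = τ ^ 2 := by rw [← heq, Real.sq_sqrt hww.le]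
      have h0 := hact heq
      have := ContinuousAt.eventually_lt (x₀ := (0 : ℝ))
        (f := fun ε => 2 * (w ⬝ᵥ g) + ε * (g ⬝ᵥ g))
        (g := fun ε => -2 * τ * β + ε * β ^ 2) (by fun_prop) (by fun_prop)
        (by simp; linarith)
      filter_upwards [nhdsWithin_le_nhds this, self_mem_nhdsWithin] with ε h hε
      have := mul_le_mul_of_nonneg_left h.le (le_of_lt hε)
      rw [hsq]; nlinarith
  have hpos : ∀ᶠ ε : ℝ in 𝓝[>] 0, 0 < τ - ε * β := by
    apply nhdsWithin_le_nhds
    exact ContinuousAt.eventually_lt (x₀ := (0 : ℝ)) (f := fun _ => (0 : ℝ))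
      (g := fun ε => τ - ε * β) (by fun_prop) (by fun_prop) (by simpa using hτ)
  filter_upwards [key, hpos] with ε h1 h2
  have := (Real.sqrt_le_left h2.le).2 h1
  linarith

open Filter Topology in
lemma eventually_one_lt_det_one_add_smul {n : Type*} [Fintype n] [DecidableEq n]
    (H : Matrix n n ℝ) (hH : 0 < H.trace) :
    ∀ᶠ ε : ℝ in 𝓝[>] 0, 1 < (1 + ε • H).det := by
  set p := ((1 + (Polynomial.X : Polynomial ℝ) • H.map Polynomial.C).det).divX.divX
  have := ContinuousAt.eventually_lt (x₀ := (0 : ℝ)) (f := fun _ => (0 : ℝ))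
    (g := fun ε => H.trace + p.eval ε * ε) (by fun_prop) (by fun_prop) (by simpa using hH)
  filter_upwards [nhdsWithin_le_nhds this, self_mem_nhdsWithin] with ε h hε
  rw [Matrix.det_one_add_smul]
  have := mul_pos h hε
  linarith

/-- The positive definite factor of the polar decomposition. -/
lemma exists_posDef_mul_self_eq {n : Type*} [Fintype n] [DecidableEq n] (M : Matrix n n ℝ)
    (hM : 0 < M.det) :
    ∃ B : Matrix n n ℝ, B.PosDef ∧ B.det = M.det ∧ B * B = Mᵀ * M := by
  open scoped MatrixOrder in
  have hpsd : (Mᵀ * M).PosSemidef := by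
    simpa using posSemidef_conjTranspose_mul_self M
  have hsq : CFC.sqrt (Mᵀ * M) * CFC.sqrt (Mᵀ * M) = Mᵀ * M :=
    CFC.sqrt_mul_sqrt_self _ hpsd.nonneg
  have hB : (CFC.sqrt (Mᵀ * M)).PosSemidef := (CFC.sqrt_nonneg _).posSemidef
  have hdet : (CFC.sqrt (Mᵀ * M)).det = M.det := by
    have := congrArg Matrix.det hsq
    rw [det_mul, det_mul, det_transpose] at this
    exact (mul_self_inj hB.det_nonneg hM.le).1 this
  exact ⟨_, hB.posDef_iff_det_ne_zero.2 (by rw [hdet]; exact hM.ne'), hdet, hsq⟩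

/-- A point is a convex combination of a finite family or is strictly separated from it. -/
lemma exists_weights_or_exists_separator {ι κ : Type*} [Fintype ι] [Fintype κ]
    (p : ι → κ → ℝ) (s : Set ι) (q : κ → ℝ) :
    (∃ l : ι → ℝ, (∀ j, 0 ≤ l j) ∧ (∀ j ∉ s, l j = 0) ∧ ∑ j, l j = 1 ∧
      ∀ k, ∑ j, l j * p j k = q k) ∨
    ∃ (h : κ → ℝ) (c : ℝ), (∀ j ∈ s, p j ⬝ᵥ h < c) ∧ c < q ⬝ᵥ h := by
  classical
  by_cases hq : q ∈ convexHull ℝ (p '' s)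
  · left
    obtain ⟨α, _, w, z, hw, hw1, hz, hzq⟩ := mem_convexHull_iff_exists_fintype.1 hq
    choose g hgs hgz using hz
    refine ⟨fun j => ∑ i with g i = j, w i, fun j => Finset.sum_nonneg fun i _ => hw i, ?_, ?_, ?_⟩
    · intro j hj
      refine Finset.sum_eq_zero fun i hi => (hj ?_).elim
      rw [← (Finset.mem_filter.1 hi).2]
      exact hgs i
    · exact (Finset.sum_fiberwise _ g w).trans hw1
    · intro k
      rw [← hzq, Finset.sum_apply, ← Finset.sum_fiberwise Finset.univ g]
      refine Finset.sum_congr rfl fun j _ => ?_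
      rw [Finset.sum_mul]
      refine Finset.sum_congr rfl fun i hi => ?_
      rw [Pi.smul_apply, ← hgz i, (Finset.mem_filter.1 hi).2, smul_eq_mul]
  · right
    have hclosed : IsClosed (convexHull ℝ (p '' s)) :=
      ((Set.toFinite s).image p).isClosed_convexHull ℝ
    obtain ⟨f, c, hf, hfq⟩ := geometric_hahn_banach_closed_point (convex_convexHull ℝ _) hclosed hq
    have hrep (x : κ → ℝ) : f x = x ⬝ᵥ fun k => f (fun i => if k = i then 1 else 0) := by
      simpa [dotProduct] using LinearMap.pi_apply_eq_sum_univ (f : (κ → ℝ) →ₗ[ℝ] ℝ) x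
    refine ⟨_, c, fun j hj => ?_, by rw [← hrep]; exact hfq⟩
    rw [← hrep]
    exact hf _ (subset_convexHull ℝ _ ⟨j, hj, rfl⟩)

/-- A maximizer of the inscribed ellipsoid problem admits no first-order improving direction. -/
lemma insFeasible.not_improving {K J : ℕ} (hK : 0 < K) {S : Matrix (Fin J) (Fin K) ℝ}
    {t : Fin J → ℝ} {B : Matrix (Fin K) (Fin K) ℝ} {d : Fin K → ℝ} (hB : insFeasible S t B d)
    (hopt : ∀ B' d', insFeasible S t B' d' → B'.det ≤ B.det)
    (H : Matrix (Fin K) (Fin K) ℝ) (e : Fin K → ℝ)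
    (hdir : ∀ j, B *ᵥ S j ≠ 0 →
      √((B *ᵥ S j) ⬝ᵥ (B *ᵥ S j)) = (K : ℝ) * t j - K * (S j ⬝ᵥ d) →
      (B *ᵥ S j) ⬝ᵥ (H *ᵥ (B *ᵥ S j))
        + ((K : ℝ) * t j - K * (S j ⬝ᵥ d)) * ((B *ᵥ S j) ⬝ᵥ e) < 0) :
    H.trace ≤ 0 := by
  by_contra! htr
  have hKne : (K : ℝ) ≠ 0 := by positivity
  have hBsymm : Bᵀ = B := by simpa using hB.1.isHermitian.eq
  have hcons : ∀ j, ∀ᶠ ε : ℝ in nhdsWithin 0 (Set.Ioi 0),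
      √((B *ᵥ S j + ε • (H *ᵥ (B *ᵥ S j))) ⬝ᵥ (B *ᵥ S j + ε • (H *ᵥ (B *ᵥ S j))))
        + ε * ((B *ᵥ S j) ⬝ᵥ e) ≤ (K : ℝ) * t j - K * (S j ⬝ᵥ d) := by
    intro j
    have hle := hB.2 j
    by_cases hw : B *ᵥ S j = 0
    · refine Filter.Eventually.of_forall fun ε => ?_
      simp only [hw, mulVec_zero, smul_zero, add_zero, zero_dotProduct, Real.sqrt_zero, mul_zero]
        at hle ⊢
      linarith
    · exact eventually_sqrt_dotProduct_add_smul_le _ _ _ _ hw (by linarith) (hdir j hw)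
  obtain ⟨ε, hε, hdet⟩ :=
    ((Filter.eventually_all.2 hcons).and (eventually_one_lt_det_one_add_smul H htr)).exists
  have hBdet := hB.1.det_pos
  have hM : B.det < ((1 + ε • H) * B).det := by
    rw [det_mul]; exact lt_mul_of_one_lt_left hBdet hdet
  obtain ⟨B', hB', hB'det, hB'sq⟩ := exists_posDef_mul_self_eq _ (hBdet.trans hM)
  refine (hopt B' (d + (ε / K) • (B *ᵥ e)) ⟨hB', fun j => ?_⟩).not_gt (hB'det ▸ hM)
  have hB'symm : B'ᵀ = B' := by simpa using hB'.isHermitian.eq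
  have hnorm : (B' *ᵥ S j) ⬝ᵥ (B' *ᵥ S j)
      = (B *ᵥ S j + ε • (H *ᵥ (B *ᵥ S j))) ⬝ᵥ (B *ᵥ S j + ε • (H *ᵥ (B *ᵥ S j))) := by
    have hMS : ((1 + ε • H) * B) *ᵥ S j = B *ᵥ S j + ε • (H *ᵥ (B *ᵥ S j)) := by
      rw [← mulVec_mulVec, add_mulVec, one_mulVec, smul_mulVec]
    have hswap (M : Matrix (Fin K) (Fin K) ℝ) :
        (M *ᵥ S j) ⬝ᵥ (M *ᵥ S j) = S j ⬝ᵥ ((Mᵀ * M) *ᵥ S j) := by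
      rw [← mulVec_mulVec, dotProduct_mulVec (S j), vecMul_transpose]
    rw [← hMS, hswap, hswap, hB'symm, hB'sq]
  have hshift : S j ⬝ᵥ (B *ᵥ e) = (B *ᵥ S j) ⬝ᵥ e := by
    rw [dotProduct_mulVec, ← mulVec_transpose, hBsymm]
  have hcenter : (K : ℝ) * (S j ⬝ᵥ (d + (ε / K) • (B *ᵥ e)))
      = K * (S j ⬝ᵥ d) + ε * ((B *ᵥ S j) ⬝ᵥ e) := by
    rw [dotProduct_add, dotProduct_smul, hshift, smul_eq_mul]
    field_simp
  rw [hnorm, hcenter]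
  linarith [hε j]

/-- John's decomposition of the identity at the contact points of a maximal inscribed
ellipsoid. -/
lemma insFeasible.exists_john_weights {K J : ℕ} (hK : 0 < K) {S : Matrix (Fin J) (Fin K) ℝ}
    {t : Fin J → ℝ} {B : Matrix (Fin K) (Fin K) ℝ} {d : Fin K → ℝ} (hB : insFeasible S t B d)
    (hopt : ∀ B' d', insFeasible S t B' d' → B'.det ≤ B.det) :
    ∃ (l r : Fin J → ℝ) (u : Fin J → Fin K → ℝ), (∀ j, 0 ≤ l j) ∧ (∑ j, l j = 1) ∧
      (∀ j, l j ≠ 0 → 0 < r j ∧ r j = (K : ℝ) * t j - K * (S j ⬝ᵥ d) ∧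
        u j ⬝ᵥ u j = 1 ∧ B *ᵥ S j = r j • u j) ∧
      (∀ a b, ∑ j, l j * (u j a * u j b) = if a = b then (K : ℝ)⁻¹ else 0) ∧
      ∀ a, ∑ j, l j * u j a = 0 := by
  have hKne : (K : ℝ) ≠ 0 := by positivity
  set r : Fin J → ℝ := fun j => √((B *ᵥ S j) ⬝ᵥ (B *ᵥ S j)) with hr
  set u : Fin J → Fin K → ℝ := fun j => (r j)⁻¹ • (B *ᵥ S j) with hu
  have hcontact (j) (hw : B *ᵥ S j ≠ 0) :
      0 < r j ∧ u j ⬝ᵥ u j = 1 ∧ B *ᵥ S j = r j • u j := by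
    have hww : 0 < (B *ᵥ S j) ⬝ᵥ (B *ᵥ S j) := by
      simpa using dotProduct_star_self_pos_iff.2 hw
    have hrpos : 0 < r j := Real.sqrt_pos.2 hww
    have hrsq : (B *ᵥ S j) ⬝ᵥ (B *ᵥ S j) = r j ^ 2 := (Real.sq_sqrt hww.le).symm
    refine ⟨hrpos, ?_, ?_⟩
    · simp only [hu, smul_dotProduct, dotProduct_smul, hrsq, smul_eq_mul]
      field_simp
    · simp only [hu, smul_smul, mul_inv_cancel₀ hrpos.ne', one_smul]
  rcases exists_weights_or_exists_separator
      (fun j => Sum.elim (fun ab : Fin K × Fin K => u j ab.1 * u j ab.2) (u j))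
      {j | B *ᵥ S j ≠ 0 ∧ r j = (K : ℝ) * t j - K * (S j ⬝ᵥ d)}
      (Sum.elim (fun ab : Fin K × Fin K => if ab.1 = ab.2 then (K : ℝ)⁻¹ else 0) 0)
    with ⟨l, hl, hls, hl1, hlq⟩ | ⟨h, c, hsep, hc⟩
  · refine ⟨l, r, u, hl, hl1, fun j hj => ?_, fun a b => hlq (.inl (a, b)),
      fun a => hlq (.inr a)⟩
    have hjs := not_imp_comm.1 (hls j) hj
    obtain ⟨h1, h2, h3⟩ := hcontact j hjs.1
    exact ⟨h1, hjs.2, h2, h3⟩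
  · exfalso
    set G : Matrix (Fin K) (Fin K) ℝ := .of fun a b => h (.inl (a, b)) with hG
    have hsplit (v : Fin K → ℝ) :
        (Sum.elim (fun ab : Fin K × Fin K => v ab.1 * v ab.2) v) ⬝ᵥ h
          = v ⬝ᵥ (G *ᵥ v) + v ⬝ᵥ fun a => h (.inr a) := by
      simp only [dotProduct, mulVec, Fintype.sum_sum_type, Fintype.sum_prod_type, Sum.elim_inl,
        Sum.elim_inr, hG, of_apply, Finset.mul_sum]
      congr 1
      refine Finset.sum_congr rfl fun a _ => Finset.sum_congr rfl fun b _ => ?_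
      ring
    have htrace : (Sum.elim (fun ab : Fin K × Fin K => if ab.1 = ab.2 then (K : ℝ)⁻¹ else 0) 0)
        ⬝ᵥ h = (K : ℝ)⁻¹ * G.trace := by
      simp [dotProduct, Fintype.sum_sum_type, Fintype.sum_prod_type, hG, trace, Finset.mul_sum,
        ite_mul]
    have hle := hB.not_improving hK hopt (G - c • 1) (fun a => h (.inr a)) fun j hw hact => by
      obtain ⟨hrpos, hu1, hwu⟩ := hcontact j hw
      have hj := hsep j ⟨hw, hact⟩
      rw [hsplit] at hj
      rw [← hact, show √((B *ᵥ S j) ⬝ᵥ (B *ᵥ S j)) = r j from rfl, hwu]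
      simp only [sub_mulVec, smul_mulVec, one_mulVec, mulVec_smul, dotProduct_sub, smul_dotProduct,
        dotProduct_smul, smul_eq_mul, hu1]
      nlinarith [mul_pos hrpos hrpos]
    rw [htrace, inv_mul_eq_div, lt_div_iff₀ (by positivity)] at hc
    rw [trace_sub, trace_smul, trace_one, Fintype.card_fin, smul_eq_mul] at hle
    linarith

/-- Contact weights turn products of the polytope's constraints into the quadratic form
`s² - (‖z‖ / K)²` of the scaled ellipsoid. -/
lemma sum_john_weights_mul {ι n : Type*} [Fintype ι] [Fintype n] [DecidableEq n]
    (l : ι → ℝ) (u : ι → n → ℝ) (κ : ℝ) (hl : ∑ j, l j = 1)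
    (huu : ∀ a b, ∑ j, l j * (u j a * u j b) = if a = b then κ else 0)
    (hu : ∀ a, ∑ j, l j * u j a = 0) (s : ℝ) (z : n → ℝ) :
    ∑ i, ∑ j, l i * l j * (1 - u i ⬝ᵥ u j) * ((s - u i ⬝ᵥ z) * (s - u j ⬝ᵥ z))
      = s ^ 2 - κ ^ 2 * (z ⬝ᵥ z) := by
  have hlin : ∑ j, l j * (s - u j ⬝ᵥ z) = s := by
    have : ∑ j, l j * (u j ⬝ᵥ z) = 0 := by
      simp only [dotProduct, Finset.mul_sum]
      rw [Finset.sum_comm]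
      refine Finset.sum_eq_zero fun a _ => ?_
      simp only [← mul_assoc, ← Finset.sum_mul, hu, zero_mul]
    simp only [mul_sub, Finset.sum_sub_distrib, ← Finset.sum_mul, hl, this]
    ring
  have hvec : ∑ j, (l j * (s - u j ⬝ᵥ z)) • u j = -κ • z := by
    ext a
    have : ∑ j, l j * (u j ⬝ᵥ z) * u j a = κ * z a := by
      simp only [dotProduct, Finset.mul_sum, Finset.sum_mul]
      rw [Finset.sum_comm]
      have (b : n) : ∑ j, l j * (u j b * z b) * u j a = (if a = b then κ else 0) * z b := by
        rw [← huu, Finset.sum_mul]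
        exact Finset.sum_congr rfl fun j _ => by ring
      simp [this]
    have hsa : ∑ j, l j * s * u j a = 0 := by
      rw [← mul_zero s, ← hu a, Finset.mul_sum]
      exact Finset.sum_congr rfl fun j _ => by ring
    simp only [Finset.sum_apply, Pi.smul_apply, smul_eq_mul, mul_sub, sub_mul,
      Finset.sum_sub_distrib, this, hsa]
    ring
  set f : ι → ℝ := fun j => l j * (s - u j ⬝ᵥ z) with hf
  have hnorm : ∑ i, ∑ j, f i * f j * (u i ⬝ᵥ u j) = κ ^ 2 * (z ⬝ᵥ z) := by
    have hvec' : ∑ j, f j • u j = -κ • z := hvec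
    have h := congrArg (fun v => v ⬝ᵥ v) hvec'
    simp only [sum_dotProduct, dotProduct_sum, smul_dotProduct, dotProduct_smul,
      smul_eq_mul, Finset.mul_sum] at h
    rw [← neg_sq, sq, mul_assoc, ← h, Finset.sum_comm]
    exact Finset.sum_congr rfl fun i _ => Finset.sum_congr rfl fun j _ => by ring
  calc _ = ∑ i, ∑ j, (f i * f j - f i * f j * (u i ⬝ᵥ u j)) :=
        Finset.sum_congr rfl fun i _ => Finset.sum_congr rfl fun j _ => by simp only [hf]; ring
    _ = (∑ i, f i) * (∑ j, f j) - ∑ i, ∑ j, f i * f j * (u i ⬝ᵥ u j) := by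
        rw [Finset.sum_mul_sum]; simp only [Finset.sum_sub_distrib]
    _ = _ := by rw [hnorm, hlin]; ring

lemma dotProduct_le_one_of_unit {n : Type*} [Fintype n] {u v : n → ℝ} (hu : u ⬝ᵥ u = 1)
    (hv : v ⬝ᵥ v = 1) : u ⬝ᵥ v ≤ 1 := by
  have h : 0 ≤ (u - v) ⬝ᵥ (u - v) := by simpa using dotProduct_star_self_nonneg (u - v)
  simp only [sub_dotProduct, dotProduct_sub, hu, hv, dotProduct_comm v u] at h
  linarith

lemma blk2_quadratic {ι : Type*} [Fintype ι] (F : Matrix ι ι ℝ) (g : ι → ℝ) (c : ℝ)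
    (x : ι ⊕ Unit → ℝ) :
    x ⬝ᵥ (blk2 F g c *ᵥ x) = (x ∘ Sum.inl) ⬝ᵥ (F *ᵥ (x ∘ Sum.inl))
      + 2 * x (.inr ()) * (g ⬝ᵥ (x ∘ Sum.inl)) + c * x (.inr ()) ^ 2 := by
  simp only [blk2, dotProduct, mulVec, Fintype.sum_sum_type, fromBlocks_apply₁₁,
    fromBlocks_apply₁₂, fromBlocks_apply₂₁, fromBlocks_apply₂₂, of_apply, Function.comp_apply,
    Finset.univ_unique, Finset.sum_singleton, PUnit.default_eq_unit, mul_add,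
    Finset.sum_add_distrib, Finset.mul_sum]
  have h : ∑ i, x (.inl i) * (g i * x (.inr ())) = ∑ i, x (.inr ()) * (g i * x (.inl i)) :=
    Finset.sum_congr rfl fun i _ => by ring
  simp only [mul_assoc, ← Finset.mul_sum] at h ⊢
  rw [h]
  ring

lemma blk2_isHermitian {ι : Type*} {F : Matrix ι ι ℝ} (hF : F.IsHermitian) (g : ι → ℝ) (c : ℝ) :
    (blk2 F g c).IsHermitian :=
  IsHermitian.fromBlocks hF (by ext; simp) (by ext; simp)

/-- The scaled maximal inscribed ellipsoid `‖B⁻¹(x - d)‖ ≤ 1` is feasible for the copositive-based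
SDP. -/
lemma insFeasible.copFeasible_inv {K J : ℕ} (hK : 0 < K) {S : Matrix (Fin J) (Fin K) ℝ}
    {t : Fin J → ℝ} {B : Matrix (Fin K) (Fin K) ℝ} {d : Fin K → ℝ} (hB : insFeasible S t B d)
    (hopt : ∀ B' d', insFeasible S t B' d' → B'.det ≤ B.det) :
    ∃ N, copFeasible S t B⁻¹ (-(B⁻¹ *ᵥ d)) N := by
  obtain ⟨l, r, u, hl, hl1, hcon, huu, hu⟩ := hB.exists_john_weights hK hopt
  have hKne : (K : ℝ) ≠ 0 := by positivity
  have hinv := hB.1.inv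
  have hBsymm : Bᵀ = B := by simpa using hB.1.isHermitian.eq
  have hinvsymm : (B⁻¹)ᵀ = B⁻¹ := by simpa using hinv.isHermitian.eq
  have hBunit : IsUnit B.det := hB.1.det_pos.ne'.isUnit
  set m : Fin J → ℝ := fun j => l j * K / r j with hm
  set N : Matrix (Fin J) (Fin J) ℝ := .of fun i j => m i * m j * (1 - u i ⬝ᵥ u j) with hN
  have hm0 (j) : 0 ≤ m j := by
    by_cases hj : l j = 0
    · simp [hm, hj]
    · have := hl j
      have := (hcon j hj).1
      positivity
  have hNsymm : N.IsHermitian := by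
    ext i j
    simp [hN, dotProduct_comm (u j) (u i), mul_comm (m j) (m i)]
  refine ⟨N, hinv, fun i j => ?_, PosSemidef.of_dotProduct_mulVec_nonneg ?_ fun x => ?_⟩
  · by_cases hi : l i = 0
    · simp [hN, hm, hi]
    by_cases hj : l j = 0
    · simp [hN, hm, hj]
    exact mul_nonneg (mul_nonneg (hm0 i) (hm0 j))
      (sub_nonneg.2 (dotProduct_le_one_of_unit (hcon i hi).2.2.1 (hcon j hj).2.2.1))
  · refine ((blk2_isHermitian isHermitian_zero _ _).sub ?_).sub (blk2_isHermitian ?_ _ _)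
    · simpa using isHermitian_conjTranspose_mul_mul (calS S t) hNsymm
    · simpa [hinvsymm] using isHermitian_conjTranspose_mul_self B⁻¹
  · apply ge_of_eq
    set y := x ∘ Sum.inl with hy
    set s := x (.inr ()) with hs
    set a := B⁻¹ *ᵥ (y - s • d) with ha
    have hconstraint (j) : (calS S t *ᵥ x) j = t j * s - S j ⬝ᵥ y := by
      simp [calS, mulVec, dotProduct, Fintype.sum_sum_type, hy, hs]
      ring
    have hcontact (j) : m j * (t j * s - S j ⬝ᵥ y) = l j * (s - u j ⬝ᵥ ((K : ℝ) • a)) := by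
      by_cases hj : l j = 0
      · simp [hm, hj]
      obtain ⟨hrpos, hrt, -, hwu⟩ := hcon j hj
      have hSa : S j ⬝ᵥ (y - s • d) = r j * (u j ⬝ᵥ a) := by
        have : y - s • d = B *ᵥ a := by
          rw [ha, mulVec_mulVec, mul_nonsing_inv _ hBunit, one_mulVec]
        rw [this, dotProduct_mulVec, ← mulVec_transpose, hBsymm, hwu, smul_dotProduct, smul_eq_mul]
      rw [dotProduct_sub, dotProduct_smul, smul_eq_mul] at hSa
      have : (K : ℝ) * (t j * s - S j ⬝ᵥ y) = r j * (s - K * (u j ⬝ᵥ a)) := by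
        linear_combination (-s) * hrt - K * hSa
      rw [dotProduct_smul, smul_eq_mul, hm]
      field_simp
      linear_combination this
    have hquad : x ⬝ᵥ (((calS S t)ᵀ * N * calS S t) *ᵥ x) = s ^ 2 - a ⬝ᵥ a := by
      rw [← mulVec_mulVec, ← mulVec_mulVec, dotProduct_mulVec x, vecMul_transpose]
      have := sum_john_weights_mul l u _ hl1 huu hu s ((K : ℝ) • a)
      rw [smul_dotProduct, dotProduct_smul, smul_eq_mul, smul_eq_mul] at this
      have hcancel : (K : ℝ)⁻¹ ^ 2 * (K * (K * (a ⬝ᵥ a))) = a ⬝ᵥ a := by field_simp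
      rw [hcancel] at this
      rw [← this]
      have hexpand (q : Fin J → ℝ) : q ⬝ᵥ (N *ᵥ q) = ∑ i, ∑ j, q i * (N i j * q j) := by
        simp only [dotProduct, mulVec, Finset.mul_sum]
      rw [hexpand]
      refine Finset.sum_congr rfl fun i _ => Finset.sum_congr rfl fun j _ => ?_
      rw [hconstraint, hconstraint, hN, of_apply]
      linear_combination (1 - u i ⬝ᵥ u j) * m j * (t j * s - S j ⬝ᵥ y) * hcontact i
        + (1 - u i ⬝ᵥ u j) * l i * (s - u i ⬝ᵥ ((K : ℝ) • a)) * hcontact j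
    have hsq : y ⬝ᵥ ((B⁻¹ * B⁻¹) *ᵥ y) = (B⁻¹ *ᵥ y) ⬝ᵥ (B⁻¹ *ᵥ y) := by
      rw [← mulVec_mulVec, dotProduct_mulVec, ← mulVec_transpose, hinvsymm]
    have hcross : (B⁻¹ *ᵥ -(B⁻¹ *ᵥ d)) ⬝ᵥ y = -((B⁻¹ *ᵥ y) ⬝ᵥ (B⁻¹ *ᵥ d)) := by
      rw [dotProduct_comm, dotProduct_mulVec, ← mulVec_transpose, hinvsymm, dotProduct_neg]
    have haa : a ⬝ᵥ a = (B⁻¹ *ᵥ y) ⬝ᵥ (B⁻¹ *ᵥ y) - 2 * s * ((B⁻¹ *ᵥ y) ⬝ᵥ (B⁻¹ *ᵥ d))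
        + s ^ 2 * ((B⁻¹ *ᵥ d) ⬝ᵥ (B⁻¹ *ᵥ d)) := by
      simp only [ha, mulVec_sub, mulVec_smul, sub_dotProduct, dotProduct_sub, smul_dotProduct,
        dotProduct_smul, smul_eq_mul, dotProduct_comm (B⁻¹ *ᵥ d) (B⁻¹ *ᵥ y)]
      ring
    rw [star_trivial, sub_mulVec, sub_mulVec, dotProduct_sub, dotProduct_sub, hquad,
      blk2_quadratic, blk2_quadratic, ← hy, ← hs, hsq, hcross, haa]
    simp
    ring

/-- The volume of the ellipsoid produced by the copositive-based SDP (∝ 1/det A*)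
never exceeds the volume of the scaled maximum-volume inscribed ellipsoid (∝ det B*). -/
theorem stmt_9 {K J : ℕ} (S : Matrix (Fin J) (Fin K) ℝ) (t : Fin J → ℝ)
    (hPc : IsCompact {x : Fin K → ℝ | S *ᵥ x ≤ t})
    (hPconv : Convex ℝ {x : Fin K → ℝ | S *ᵥ x ≤ t})
    (hPint : (interior {x : Fin K → ℝ | S *ᵥ x ≤ t}).Nonempty)
    (A : Matrix (Fin K) (Fin K) ℝ) (b : Fin K → ℝ) (N : Matrix (Fin J) (Fin J) ℝ)
    (hAfeas : copFeasible S t A b N)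
    (hAopt : ∀ A' b' N', copFeasible S t A' b' N' → A'.det ≤ A.det)
    (B : Matrix (Fin K) (Fin K) ℝ) (d : Fin K → ℝ)
    (hBfeas : insFeasible S t B d)
    (hBopt : ∀ B' d', insFeasible S t B' d' → B'.det ≤ B.det) :
    1 / A.det ≤ B.det := by
  have hBdet := hBfeas.1.det_pos
  rcases Nat.eq_zero_or_pos K with rfl | hK
  · simp
  · obtain ⟨N', hN'⟩ := hBfeas.copFeasible_inv hK hBopt
    have h := hAopt _ _ _ hN'
    rw [det_nonsing_inv, Ring.inverse_eq_inv'] at h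
    rw [one_div]
    exact inv_le_of_inv_le₀ hBdet h
end
end

section
/- Let P = {x ∈ ℝ^K : Sx ≤ t} (with S ∈ ℝ^{J×K}, t ∈ ℝ^J) be a polytope that is compact, convex, and has nonempty interior. Let Q ∈ ℝ^{K×K} be symmetric positive definite and q ∈ ℝ^K be such that P ⊆ E(Q,q) and the center x_c = −Q⁻¹q of E(Q,q) lies in P (i.e., S·x_c ≤ t). Call a tuple (A, b, λ, μ), with A ∈ ℝ^{K×K} symmetric, b ∈ ℝ^K, λ ≥ 0, and μ ∈ ℝ^J entrywise nonnegative, feasible if the (2K+1)×(2K+1) block matrix [[0, (1/2)Sᵀμ, A],[(1/2)(Sᵀμ)ᵀ, 1 − μᵀt, bᵀ],[A, b, I_K]] + λ·[[Q², Qq, 0],[(Qq)ᵀ, qᵀq − 1, 0],[0, 0, 0]] is positive semidefinite. Then (A, b, λ, μ) = (Q, q, 1, 0) is feasible, and every feasible (A, b, λ, μ) with A positive definite satisfies det A ≤ det Q. -/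
open Matrix

noncomputable section

/-- The matrix appearing in the 𝒮-procedure SDP for a polytope with a redundant
quadratic (ellipsoidal) constraint `‖Qx + q‖² ≤ 1`:
`[[0, (1/2)Sᵀμ, A],[(1/2)(Sᵀμ)ᵀ, 1 − μᵀt, bᵀ],[A, b, I]] + λ·[[Q², Qq, 0],[(Qq)ᵀ, qᵀq−1, 0],[0,0,0]]`. -/
def sprocMat {K J : ℕ} (S : Matrix (Fin J) (Fin K) ℝ) (t : Fin J → ℝ)
    (Q : Matrix (Fin K) (Fin K) ℝ) (q : Fin K → ℝ)
    (A : Matrix (Fin K) (Fin K) ℝ) (b : Fin K → ℝ) (lam : ℝ) (μ : Fin J → ℝ) :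
    Matrix ((Fin K ⊕ Unit) ⊕ Fin K) ((Fin K ⊕ Unit) ⊕ Fin K) ℝ :=
  blk3 0 ((1/2 : ℝ) • (Sᵀ *ᵥ μ)) (1 - μ ⬝ᵥ t) A b +
    lam • Matrix.fromBlocks (blk2 (Q * Q) (Q *ᵥ q) (q ⬝ᵥ q - 1)) 0 0 0

/-- Feasibility of a tuple `(A, b, λ, μ)` in the 𝒮-procedure SDP. -/
def sprocFeasible {K J : ℕ} (S : Matrix (Fin J) (Fin K) ℝ) (t : Fin J → ℝ)
    (Q : Matrix (Fin K) (Fin K) ℝ) (q : Fin K → ℝ)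
    (A : Matrix (Fin K) (Fin K) ℝ) (b : Fin K → ℝ) (lam : ℝ) (μ : Fin J → ℝ) : Prop :=
  A.IsSymm ∧ 0 ≤ lam ∧ (∀ j, 0 ≤ μ j) ∧ (sprocMat S t Q q A b lam μ).PosSemidef

namespace Matrix

/-- A real square matrix that does not increase the Euclidean norm has determinant at most `1`
in absolute value. -/
theorem det_sq_le_one_of_contraction {n : Type*} [Fintype n] [DecidableEq n] (N : Matrix n n ℝ)
    (hN : ∀ x, (N *ᵥ x) ⬝ᵥ (N *ᵥ x) ≤ x ⬝ᵥ x) : N.det ^ 2 ≤ 1 := by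
  have hps : (Nᵀ * N).PosSemidef := by
    simpa using posSemidef_conjTranspose_mul_self N
  have hdet : N.det ^ 2 = ∏ i, hps.isHermitian.eigenvalues i := by
    have h := hps.isHermitian.det_eq_prod_eigenvalues
    rw [det_mul, det_transpose] at h
    rw [sq, h]
    simp
  rw [hdet]
  refine Finset.prod_le_one (fun i _ => hps.eigenvalues_nonneg i) fun i _ => ?_
  have hunit : (hps.isHermitian.eigenvectorBasis i).ofLp ⬝ᵥ
      (hps.isHermitian.eigenvectorBasis i).ofLp = 1 := by
    have h := EuclideanSpace.inner_eq_star_dotProduct (𝕜 := ℝ)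
      (hps.isHermitian.eigenvectorBasis i) (hps.isHermitian.eigenvectorBasis i)
    rw [real_inner_self_eq_norm_sq, hps.isHermitian.eigenvectorBasis.orthonormal.1 i] at h
    simpa using h.symm
  have h := hN (hps.isHermitian.eigenvectorBasis i).ofLp
  rw [hunit] at h
  rw [hps.isHermitian.eigenvalues_eq i, ← mulVec_mulVec, dotProduct_mulVec, vecMul_transpose]
  simpa using h

/-- If `‖A x‖ ≤ ‖B x‖` for all `x` and `B` is invertible, then `det A ^ 2 ≤ det B ^ 2`. -/
theorem det_sq_le_det_sq_of_mulVec_le {n : Type*} [Fintype n] [DecidableEq n]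
    {A B : Matrix n n ℝ} (hB : IsUnit B.det)
    (h : ∀ x, (A *ᵥ x) ⬝ᵥ (A *ᵥ x) ≤ (B *ᵥ x) ⬝ᵥ (B *ᵥ x)) : A.det ^ 2 ≤ B.det ^ 2 := by
  have hN := det_sq_le_one_of_contraction (A * B⁻¹) fun x => by
    simpa [← mulVec_mulVec, mulVec_mulVec x B B⁻¹, mul_nonsing_inv B hB] using h (B⁻¹ *ᵥ x)
  calc A.det ^ 2 = (A * B⁻¹).det ^ 2 * B.det ^ 2 := by
        rw [← mul_pow, ← det_mul, nonsing_inv_mul_cancel_right B A hB]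
    _ ≤ B.det ^ 2 := mul_le_of_le_one_left (sq_nonneg _) hN

end Matrix

theorem sprocMat_isHermitian {K J : ℕ} (S : Matrix (Fin J) (Fin K) ℝ) (t : Fin J → ℝ)
    {Q : Matrix (Fin K) (Fin K) ℝ} (hQ : Q.IsSymm) (q : Fin K → ℝ)
    {A : Matrix (Fin K) (Fin K) ℝ} (hA : A.IsSymm) (b : Fin K → ℝ) (lam : ℝ) (μ : Fin J → ℝ) :
    (sprocMat S t Q q A b lam μ).IsHermitian := by
  have hQQ : (Q * Q).IsSymm := by rw [IsSymm, transpose_mul, hQ.eq]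
  ext ((i | i) | i) ((j | j) | j) <;>
    simp [sprocMat, blk3, blk2, hQQ.apply, hA.apply, one_apply, eq_comm]

/-- The quadratic form of `sprocMat` at the block vector `(x, s, z)`. -/
theorem dotProduct_sprocMat_mulVec {K J : ℕ} (S : Matrix (Fin J) (Fin K) ℝ) (t : Fin J → ℝ)
    {Q : Matrix (Fin K) (Fin K) ℝ} (hQ : Q.IsSymm) (q : Fin K → ℝ)
    {A : Matrix (Fin K) (Fin K) ℝ} (hA : A.IsSymm) (b : Fin K → ℝ) (lam : ℝ) (μ : Fin J → ℝ)
    (x : Fin K → ℝ) (s : ℝ) (z : Fin K → ℝ) :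
    Sum.elim (Sum.elim x fun _ => s) z ⬝ᵥ
        (sprocMat S t Q q A b lam μ *ᵥ Sum.elim (Sum.elim x fun _ => s) z) =
      s * (μ ⬝ᵥ (S *ᵥ x)) + s ^ 2 * (1 - μ ⬝ᵥ t) + 2 * (z ⬝ᵥ (A *ᵥ x)) + 2 * s * (z ⬝ᵥ b) +
        z ⬝ᵥ z + lam * ((Q *ᵥ x + s • q) ⬝ᵥ (Q *ᵥ x + s • q) - s ^ 2) := by
  have hcol (g : Fin K → ℝ) : (of fun i (_ : Unit) => g i) *ᵥ (fun _ => s) = s • g := by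
    ext; simp [mulVec, dotProduct, mul_comm]
  have hrow (g y : Fin K → ℝ) : (of fun (_ : Unit) j => g j) *ᵥ y = fun _ => g ⬝ᵥ y := rfl
  have hconst (c d : ℝ) : (fun _ : Unit => c) ⬝ᵥ (fun _ => d) = c * d := by simp [dotProduct]
  have hcorner (c : ℝ) : (of fun (_ _ : Unit) => c) *ᵥ (fun _ => s) = fun _ => c * s := by
    ext; simp [mulVec, dotProduct]
  have htop : (of (Sum.elim (fun i j => A i j) fun _ j => b j) :
      Matrix (Fin K ⊕ Unit) (Fin K) ℝ) *ᵥ z = Sum.elim (A *ᵥ z) fun _ => b ⬝ᵥ z := by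
    ext (i | i) <;> rfl
  have hbot : (of fun i => Sum.elim (fun j => A i j) fun _ => b i :
      Matrix (Fin K) (Fin K ⊕ Unit) ℝ) *ᵥ (Sum.elim x fun _ => s) = A *ᵥ x + s • b := by
    ext i; simp [mulVec, dotProduct, mul_comm]
  have hQx : x ⬝ᵥ (Q *ᵥ (Q *ᵥ x)) = (Q *ᵥ x) ⬝ᵥ (Q *ᵥ x) := by
    rw [dotProduct_mulVec, ← mulVec_transpose, hQ.eq]
  have hQq : x ⬝ᵥ (Q *ᵥ q) = (Q *ᵥ x) ⬝ᵥ q := by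
    rw [dotProduct_mulVec, ← mulVec_transpose, hQ.eq]
  have hAz : x ⬝ᵥ (A *ᵥ z) = z ⬝ᵥ (A *ᵥ x) := by
    rw [dotProduct_mulVec, ← mulVec_transpose, hA.eq, dotProduct_comm]
  have hS : x ⬝ᵥ (Sᵀ *ᵥ μ) = μ ⬝ᵥ (S *ᵥ x) := by
    rw [mulVec_transpose, dotProduct_comm, dotProduct_mulVec]
  simp only [sprocMat, blk3, blk2, add_mulVec, smul_mulVec, fromBlocks_mulVec, Sum.elim_comp_inl,
    Sum.elim_comp_inr, hcol, hrow, hcorner, htop, hbot, zero_mulVec, one_mulVec, zero_add,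
    add_zero, dotProduct_add, dotProduct_smul, add_dotProduct, smul_dotProduct,
    sumElim_dotProduct_sumElim, hconst, ← mulVec_mulVec, hQx, hQq, hAz, hS, smul_eq_mul,
    dotProduct_comm (Q *ᵥ q) x, dotProduct_comm (Sᵀ *ᵥ μ) x, dotProduct_comm b z,
    dotProduct_comm q (Q *ᵥ x), dotProduct_zero]
  ring

/-- If the center of a bounding ellipsoid `E(Q,q)` of the polytope `P = {x : Sx ≤ t}`
lies inside `P`, then the 𝒮-procedure does not improve on `E(Q,q)`:
`(Q, q, 1, 0)` is feasible, and every feasible tuple with `A` positive definite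
satisfies `det A ≤ det Q`. -/
theorem stmt_10 {K J : ℕ} (S : Matrix (Fin J) (Fin K) ℝ) (t : Fin J → ℝ)
    (hPc : IsCompact {x : Fin K → ℝ | S *ᵥ x ≤ t})
    (hPconv : Convex ℝ {x : Fin K → ℝ | S *ᵥ x ≤ t})
    (hPint : (interior {x : Fin K → ℝ | S *ᵥ x ≤ t}).Nonempty)
    (Q : Matrix (Fin K) (Fin K) ℝ) (hQ : Q.PosDef) (q : Fin K → ℝ)
    (hcover : {x : Fin K → ℝ | S *ᵥ x ≤ t} ⊆ ellipsoid Q q)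
    (hcenter : S *ᵥ (-(Q⁻¹ *ᵥ q)) ≤ t) :
    sprocFeasible S t Q q Q q 1 0 ∧
      ∀ (A : Matrix (Fin K) (Fin K) ℝ) (b : Fin K → ℝ) (lam : ℝ) (μ : Fin J → ℝ),
        sprocFeasible S t Q q A b lam μ → A.PosDef → A.det ≤ Q.det := by
  have hQs : Q.IsSymm := by simpa [IsHermitian] using! hQ.isHermitian
  refine ⟨⟨hQs, zero_le_one, fun _ => le_rfl, ?_⟩, ?_⟩
  · refine posSemidef_iff_dotProduct_mulVec.2
      ⟨sprocMat_isHermitian S t hQs q hQs q 1 0, fun v => ?_⟩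
    obtain ⟨x, s, z, rfl⟩ : ∃ x s z, v = Sum.elim (Sum.elim x fun _ => s) z :=
      ⟨fun i => v (.inl (.inl i)), v (.inl (.inr ())), fun i => v (.inr i), by
        ext ((i | i) | i) <;> rfl⟩
    rw [star_trivial, dotProduct_sprocMat_mulVec S t hQs q hQs]
    have h : 0 ≤ (z + (Q *ᵥ x + s • q)) ⬝ᵥ (z + (Q *ᵥ x + s • q)) :=
      Finset.sum_nonneg fun i _ => mul_self_nonneg _
    rw [add_dotProduct, dotProduct_add z, dotProduct_add (Q *ᵥ x + s • q),
      dotProduct_comm (Q *ᵥ x + s • q) z, dotProduct_add z, dotProduct_smul s z] at h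
    simp only [zero_dotProduct, smul_eq_mul] at h ⊢
    linarith
  · rintro A b lam μ ⟨hAs, -, hμ, hM⟩ hA
    have hform (x : Fin K → ℝ) (s : ℝ) (z : Fin K → ℝ) :=
      (dotProduct_sprocMat_mulVec S t hQs q hAs b lam μ x s z) ▸
        (posSemidef_iff_dotProduct_mulVec.1 hM).2 (Sum.elim (Sum.elim x fun _ => s) z)
    have hQu : IsUnit Q.det := hQ.det_pos.ne'.isUnit
    have hlam : lam ≤ 1 := by
      have h := hform (-(Q⁻¹ *ᵥ q)) 1 0
      have hμS : μ ⬝ᵥ (S *ᵥ -(Q⁻¹ *ᵥ q)) ≤ μ ⬝ᵥ t :=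
        Finset.sum_le_sum fun j _ => mul_le_mul_of_nonneg_left (hcenter j) (hμ j)
      have hres : Q *ᵥ -(Q⁻¹ *ᵥ q) + (1 : ℝ) • q = 0 := by
        rw [mulVec_neg, mulVec_mulVec, mul_nonsing_inv Q hQu]
        simp
      rw [hres] at h
      simp only [zero_dotProduct] at h
      linarith
    refine (sq_le_sq₀ hA.det_pos.le hQ.det_pos.le).1
      (det_sq_le_det_sq_of_mulVec_le hQu fun x => ?_)
    have h := hform x 0 (-(A *ᵥ x))
    simp only [neg_dotProduct, dotProduct_neg, zero_smul, add_zero] at h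
    have hQx : 0 ≤ (Q *ᵥ x) ⬝ᵥ (Q *ᵥ x) := Finset.sum_nonneg fun i _ => mul_self_nonneg _
    nlinarith [mul_le_of_le_one_left hQx hlam]
end
end

section
/- Fix an integer K ≥ 2 and consider the chipped hypercube P = {x ∈ ℝ^K : 0 ≤ x ≤ e, eᵀx ≤ √K}, written as P = {x : Sx ≤ t} with S = [I_K; −I_K; eᵀ] ∈ ℝ^{(2K+1)×K} and t = (e; 0; √K) ∈ ℝ^{2K+1}. Define k₁ = √((K² − 1)/((√K − 1)K²)), k₂ = (1 + 1/K − k₁)/K, k₃ = −1/√K, k₄ = k₁²/2, k₅ = k₂(k₁ + (K/2)k₂), and set A = k₁·I_K + k₂·eeᵀ, b = k₃·e, and N ∈ ℝ^{(2K+1)×(2K+1)} the block matrix [[0, k₄·I_K, 0],[k₄·I_K, 0, k₅·e],[0, k₅·eᵀ, 0]]. Then: (i) A is symmetric positive definite and N is entrywise nonnegative; (ii) [[A², Ab],[(Ab)ᵀ, bᵀb]] ⪯ [[0,0],[0,1]] − 𝒮ᵀN𝒮 in the Loewner order, where 𝒮 = [−S t]; (iii) det A = (1 + 1/K)·k₁^{K−1};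 and (iv) there is an absolute constant c > 0 such that ((1 + 1/K)·k₁^{K−1})^{−1/K} ≤ c·K^{1/4} for all integers K ≥ 2. -/
open Matrix

noncomputable section

/-- Constraint matrix `S = [I_K; −I_K; eᵀ]` of the chipped hypercube
`{x : 0 ≤ x ≤ e, eᵀx ≤ √K}`. -/
def chipS (K : ℕ) : Matrix ((Fin K ⊕ Fin K) ⊕ Unit) (Fin K) ℝ :=
  Matrix.of (Sum.elim
    (Sum.elim (fun i j => if i = j then 1 else 0) (fun i j => if i = j then -1 else 0))
    (fun _ _ => 1))

/-- Right-hand side `t = (e; 0; √K)` of the chipped hypercube. -/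
def chipt (K : ℕ) : (Fin K ⊕ Fin K) ⊕ Unit → ℝ :=
  Sum.elim (Sum.elim (fun _ => 1) (fun _ => 0)) (fun _ => Real.sqrt K)

def k1 (K : ℕ) : ℝ := Real.sqrt (((K : ℝ) ^ 2 - 1) / ((Real.sqrt K - 1) * (K : ℝ) ^ 2))

def k2 (K : ℕ) : ℝ := (1 + 1 / (K : ℝ) - k1 K) / (K : ℝ)

def k3 (K : ℕ) : ℝ := -(1 / Real.sqrt K)

def k4 (K : ℕ) : ℝ := (k1 K) ^ 2 / 2

def k5 (K : ℕ) : ℝ := k2 K * (k1 K + ((K : ℝ) / 2) * k2 K)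

/-- `A = k₁ I + k₂ eeᵀ`. -/
def chipA (K : ℕ) : Matrix (Fin K) (Fin K) ℝ :=
  k1 K • (1 : Matrix (Fin K) (Fin K) ℝ) + k2 K • Matrix.of (fun _ _ => (1 : ℝ))

/-- `b = k₃ e`. -/
def chipb (K : ℕ) : Fin K → ℝ := fun _ => k3 K

/-- `N = [[0, k₄ I, 0],[k₄ I, 0, k₅ e],[0, k₅ eᵀ, 0]]`. -/
def chipN (K : ℕ) : Matrix ((Fin K ⊕ Fin K) ⊕ Unit) ((Fin K ⊕ Fin K) ⊕ Unit) ℝ :=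
  Matrix.fromBlocks
    (Matrix.fromBlocks 0 (k4 K • (1 : Matrix (Fin K) (Fin K) ℝ))
      (k4 K • (1 : Matrix (Fin K) (Fin K) ℝ)) 0)
    (Matrix.of (Sum.elim (fun _ _ => (0 : ℝ)) (fun _ _ => k5 K)))
    (Matrix.of fun _ => Sum.elim (fun _ => (0 : ℝ)) (fun _ => k5 K))
    0

theorem sqrt_sub_one_pos {K : ℕ} (hK : 2 ≤ K) : 0 < √(K : ℝ) - 1 := by
  have hK' : (1 : ℝ) < K := by exact_mod_cast hK
  exact sub_pos.2 (Real.lt_sqrt_of_sq_lt (by linarith))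

theorem k1_sq {K : ℕ} (hK : 2 ≤ K) : k1 K ^ 2 * (√K - 1) = 1 - 1 / (K : ℝ) ^ 2 := by
  have hK' : (2 : ℝ) ≤ K := by exact_mod_cast hK
  have hs := sqrt_sub_one_pos hK
  have hn : (0 : ℝ) ≤ (K : ℝ) ^ 2 - 1 := by nlinarith
  rw [k1, Real.sq_sqrt (by positivity)]
  field_simp

theorem k1_pos {K : ℕ} (hK : 2 ≤ K) : 0 < k1 K := by
  have hK' : (2 : ℝ) ≤ K := by exact_mod_cast hK
  have hs := sqrt_sub_one_pos hK
  have hn : (0 : ℝ) < (K : ℝ) ^ 2 - 1 := by nlinarith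
  exact Real.sqrt_pos.2 (by positivity)

theorem k1_le {K : ℕ} (hK : 2 ≤ K) : k1 K ≤ 1 + 1 / (K : ℝ) := by
  have hK' : (2 : ℝ) ≤ K := by exact_mod_cast hK
  have hs := sqrt_sub_one_pos hK
  have hsq : √(K : ℝ) ^ 2 = K := Real.sq_sqrt (by linarith)
  rw [k1, Real.sqrt_le_left (by positivity), div_le_iff₀ (by positivity)]
  have hexp : (1 + 1 / (K : ℝ)) ^ 2 * ((√K - 1) * (K : ℝ) ^ 2) = (K + 1) ^ 2 * (√K - 1) := by
    field_simp
  rw [hexp]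
  generalize √(K : ℝ) = r at *
  rw [← hsq]
  have hr : 0 ≤ (r ^ 2 + 1) * (r - 1) * (r * (r - 1)) := by
    have : 0 < r := by linarith
    positivity
  linear_combination hr

theorem k1_add_mul_k2 {K : ℕ} (hK : 2 ≤ K) : k1 K + K * k2 K = 1 + 1 / (K : ℝ) := by
  have : (K : ℝ) ≠ 0 := by positivity
  rw [k2]
  field_simp
  ring

theorem k2_nonneg {K : ℕ} (hK : 2 ≤ K) : 0 ≤ k2 K :=
  div_nonneg (sub_nonneg.2 (k1_le hK)) K.cast_nonneg

theorem k4_nonneg (K : ℕ) : 0 ≤ k4 K := by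
  unfold k4
  positivity

theorem k5_nonneg {K : ℕ} (hK : 2 ≤ K) : 0 ≤ k5 K := by
  have h1 := k1_pos hK
  have h2 := k2_nonneg hK
  unfold k5
  positivity

/-- The off-diagonal entries of the two sides of the semidefinite constraint agree. -/
theorem k4_add_sqrt_mul_k5 {K : ℕ} (hK : 2 ≤ K) :
    k4 K + √K * k5 K + (k1 K + K * k2 K) * k3 K = 0 := by
  have hK0 : (0 : ℝ) < K := by positivity
  have hr : 0 < √(K : ℝ) := Real.sqrt_pos.2 hK0
  have hsq : √(K : ℝ) ^ 2 = K := Real.sq_sqrt hK0.le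
  have h1 := k1_sq hK
  rw [k1_add_mul_k2 hK, k5, k4, k3, k2]
  generalize √(K : ℝ) = r at *
  generalize k1 K = k at *
  rw [← hsq] at h1 ⊢
  field_simp at h1 ⊢
  linear_combination h1

theorem chipA_posDef {K : ℕ} (hK : 2 ≤ K) : (chipA K).PosDef := by
  have hones : (Matrix.of fun _ _ => (1 : ℝ) : Matrix (Fin K) (Fin K) ℝ).PosSemidef := by
    convert posSemidef_vecMulVec_self_star (1 : Fin K → ℝ)
    ext i j
    simp [vecMulVec_apply]
  exact (PosDef.one.smul (k1_pos hK)).add_posSemidef (hones.smul (k2_nonneg hK))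

theorem chipN_nonneg {K : ℕ} (hK : 2 ≤ K) (i j) : 0 ≤ chipN K i j := by
  have h4 := k4_nonneg K
  have h5 := k5_nonneg hK
  rcases i with (i | i) | i <;> rcases j with (j | j) | j <;>
    simp [chipN, Matrix.one_apply] <;> first | assumption | (split_ifs <;> simp [h4])

theorem det_chipA {K : ℕ} (hK : 2 ≤ K) :
    (chipA K).det = (1 + 1 / (K : ℝ)) * k1 K ^ (K - 1) := by
  have h1 := (k1_pos hK).ne'
  have hA : chipA K = k1 K • (1 + replicateCol Unit (fun _ : Fin K => k2 K / k1 K) *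
      replicateRow Unit (fun _ : Fin K => (1 : ℝ))) := by
    ext i j
    simp [chipA, Matrix.mul_apply, mul_add, mul_div_cancel₀, h1]
  rw [hA, det_smul, det_one_add_replicateCol_mul_replicateRow, ← k1_add_mul_k2 hK]
  obtain ⟨n, rfl⟩ : ∃ n, K = n + 1 := ⟨K - 1, by omega⟩
  simp [dotProduct]
  field_simp
  ring

/-- The semidefinite constraint holds with equality. -/
theorem chip_constraint_eq_zero {K : ℕ} (hK : 2 ≤ K) :
    blk2 (0 : Matrix (Fin K) (Fin K) ℝ) (0 : Fin K → ℝ) 1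
      - (calS (chipS K) (chipt K))ᵀ * chipN K * calS (chipS K) (chipt K)
      - blk2 (chipA K * chipA K) (chipA K *ᵥ chipb K) (chipb K ⬝ᵥ chipb K) = 0 := by
  have hK0 : (0 : ℝ) < K := by positivity
  have hsq : √(K : ℝ) ^ 2 = K := Real.sq_sqrt hK0.le
  have h := k4_add_sqrt_mul_k5 hK
  have hb : (K : ℝ) * (k3 K * k3 K) = 1 := by
    rw [k3, neg_mul_neg, div_mul_div_comm, ← sq √(K : ℝ), hsq]
    field_simp
  ext i j
  rcases i with i | i <;> rcases j with j | j
  · simp [blk2, calS, chipS, chipt, chipN, chipA, Matrix.mul_apply, Fintype.sum_sum_type,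
      Matrix.one_apply, Finset.sum_add_distrib, add_mul, mul_add, k4, k5]
    split_ifs <;> ring
  · simp [blk2, calS, chipS, chipt, chipN, chipA, chipb, Matrix.mul_apply, mulVec, dotProduct,
      Fintype.sum_sum_type, Matrix.one_apply, Finset.sum_add_distrib, add_mul, mul_add]
    linarith
  · simp [blk2, calS, chipS, chipt, chipN, chipA, chipb, Matrix.mul_apply, mulVec, dotProduct,
      Fintype.sum_sum_type, Matrix.one_apply, Finset.sum_add_distrib, add_mul, mul_add]
    linarith
  · simp [blk2, calS, chipS, chipt, chipN, chipb, Matrix.mul_apply, dotProduct,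
      Fintype.sum_sum_type, Matrix.one_apply, hb]

theorem rpow_neg_quarter_le_k1 {K : ℕ} (hK : 2 ≤ K) :
    1 / 2 * (K : ℝ) ^ (-(1 : ℝ) / 4) ≤ k1 K := by
  have hK' : (2 : ℝ) ≤ K := by exact_mod_cast hK
  have hs := sqrt_sub_one_pos hK
  have hq : ((K : ℝ) ^ (-(1 : ℝ) / 4)) ^ 2 * √K = 1 := by
    rw [← Real.rpow_natCast, ← Real.rpow_mul (by positivity), Real.sqrt_eq_rpow,
      ← Real.rpow_add (by positivity)]
    norm_num
  refine le_of_sq_le_sq ?_ (k1_pos hK).le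
  refine le_of_mul_le_mul_right ?_ hs
  have hK2 : 1 / (K : ℝ) ^ 2 ≤ 1 / 2 ^ 2 := by gcongr
  rw [k1_sq hK]
  nlinarith [sq_nonneg ((K : ℝ) ^ (-(1 : ℝ) / 4))]

theorem radius_le {K : ℕ} (hK : 2 ≤ K) :
    ((1 + 1 / (K : ℝ)) * k1 K ^ (K - 1)) ^ (-(1 : ℝ) / (K : ℝ)) ≤
      2 * (K : ℝ) ^ ((1 : ℝ) / 4) := by
  have hK' : (2 : ℝ) ≤ K := by exact_mod_cast hK
  set q := 1 / 2 * (K : ℝ) ^ (-(1 : ℝ) / 4) with hq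
  have hq0 : 0 < q := by positivity
  have hq1 : q ≤ 1 := by
    have : (K : ℝ) ^ (-(1 : ℝ) / 4) ≤ 1 :=
      Real.rpow_le_one_of_one_le_of_nonpos (by linarith) (by norm_num)
    linarith
  have hle : q ^ K ≤ (1 + 1 / (K : ℝ)) * k1 K ^ (K - 1) := calc
    q ^ K ≤ q ^ (K - 1) := pow_le_pow_of_le_one hq0.le hq1 (Nat.sub_le K 1)
    _ ≤ k1 K ^ (K - 1) := pow_le_pow_left₀ hq0.le (rpow_neg_quarter_le_k1 hK) _
    _ ≤ (1 + 1 / (K : ℝ)) * k1 K ^ (K - 1) :=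
      le_mul_of_one_le_left (pow_nonneg (k1_pos hK).le _) (le_add_of_nonneg_right (by positivity))
  calc ((1 + 1 / (K : ℝ)) * k1 K ^ (K - 1)) ^ (-(1 : ℝ) / (K : ℝ))
      ≤ (q ^ K) ^ (-(1 : ℝ) / (K : ℝ)) :=
        Real.rpow_le_rpow_of_nonpos (by positivity) hle
          (div_nonpos_of_nonpos_of_nonneg (by norm_num) (by positivity))
    _ = q⁻¹ := by
        rw [← Real.rpow_natCast, ← Real.rpow_mul hq0.le, mul_div_cancel₀ _ (by positivity),
          Real.rpow_neg_one]
    _ = 2 * (K : ℝ) ^ ((1 : ℝ) / 4) := by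
        rw [hq, mul_inv, ← Real.rpow_neg (by positivity)]
        norm_num

/-- The explicit solution for the chipped hypercube is feasible in the
copositive-based SDP, its determinant is `(1 + 1/K)·k₁^{K−1}`, and the resulting
radius grows as `O(K^{1/4})`. -/
theorem stmt_15 (K : ℕ) (hK : 2 ≤ K) :
    (chipA K).PosDef ∧
    (∀ i j, 0 ≤ chipN K i j) ∧
    (blk2 (0 : Matrix (Fin K) (Fin K) ℝ) (0 : Fin K → ℝ) 1
      - (calS (chipS K) (chipt K))ᵀ * chipN K * calS (chipS K) (chipt K)
      - blk2 (chipA K * chipA K) (chipA K *ᵥ chipb K) (chipb K ⬝ᵥ chipb K)).PosSemidef ∧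
    (chipA K).det = (1 + 1 / (K : ℝ)) * k1 K ^ (K - 1) ∧
    ∃ c : ℝ, 0 < c ∧ ∀ K' : ℕ, 2 ≤ K' →
      ((1 + 1 / (K' : ℝ)) * k1 K' ^ (K' - 1)) ^ (-(1 : ℝ) / (K' : ℝ)) ≤
        c * (K' : ℝ) ^ ((1 : ℝ) / 4) := by
  exact ⟨chipA_posDef hK, chipN_nonneg hK, chip_constraint_eq_zero hK ▸ PosSemidef.zero,
    det_chipA hK, 2, two_pos, fun _ => radius_le⟩
end
end

section
/- Fix an integer K ≥ 2 and consider the chipped hypercube P = {x ∈ ℝ^K : 0 ≤ x ≤ e, eᵀx ≤ √K}, written as P = {x : Sx ≤ t} with S = [I_K; −I_K; eᵀ] ∈ ℝ^{(2K+1)×K} and t = (e; 0; √K) ∈ ℝ^{2K+1}. Define m₁ = K/√(K+1), m₂ = 1/(K+1) − 1/√(K+1), m₃ = √K/(K+1), and set B = m₁·I_K + m₂·eeᵀ and d = m₃·e. Call a pair (B', d') with B' ∈ ℝ^{K×K} symmetric positive definite and d' ∈ ℝ^K feasible if ‖B'·S_{j:}‖ + K·(S_{j:}ᵀ d') ≤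 K·t_j for every row index j, where S_{j:} ∈ ℝ^K is the transpose of the j-th row of S. Then: (i) B is symmetric positive definite and (B, d) is feasible; (ii) det B = K^K/(K+1)^{(K+1)/2}; (iii) every feasible pair (B', d') satisfies det B' ≤ K^K/(K+1)^{(K+1)/2}; and (iv) lim_{K→∞} (det B)^{1/K}/√K = 1. -/
open Matrix Filter

noncomputable section

def m1 (K : ℕ) : ℝ := (K : ℝ) / Real.sqrt ((K : ℝ) + 1)

def m2 (K : ℕ) : ℝ := 1 / ((K : ℝ) + 1) - 1 / Real.sqrt ((K : ℝ) + 1)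

def m3 (K : ℕ) : ℝ := Real.sqrt K / ((K : ℝ) + 1)

/-- `B = m₁ I + m₂ eeᵀ`. -/
def chipB (K : ℕ) : Matrix (Fin K) (Fin K) ℝ :=
  m1 K • (1 : Matrix (Fin K) (Fin K) ℝ) + m2 K • Matrix.of (fun _ _ => (1 : ℝ))

/-- `d = m₃ e`. -/
def chipd (K : ℕ) : Fin K → ℝ := fun _ => m3 K

/-- Feasibility in the scaled maximum-volume inscribed ellipsoid problem for the
chipped hypercube: `B'` symmetric positive definite and
`‖B'·S_{j:}‖ + K·(S_{j:}ᵀ d') ≤ K·t_j` for every row `j`. -/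
def smvieFeasible (K : ℕ) (B' : Matrix (Fin K) (Fin K) ℝ) (d' : Fin K → ℝ) : Prop :=
  B'.PosDef ∧ ∀ j, Real.sqrt ((B' *ᵥ chipS K j) ⬝ᵥ (B' *ᵥ chipS K j))
    + (K : ℝ) * (chipS K j ⬝ᵥ d') ≤ (K : ℝ) * chipt K j

theorem det_smul_one_add_smul_ones (n : ℕ) (a b : ℝ) (ha : a ≠ 0) :
    (a • (1 : Matrix (Fin n) (Fin n) ℝ) + b • Matrix.of (fun _ _ => (1 : ℝ))).det
      = a ^ n * (1 + n * (b / a)) := by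
  have h : a • (1 : Matrix (Fin n) (Fin n) ℝ) + b • Matrix.of (fun _ _ => (1 : ℝ))
      = a • (1 + replicateCol Unit (fun _ => b / a) * replicateRow Unit (fun _ => (1 : ℝ))) := by
    ext i j
    simp only [Matrix.add_apply, Matrix.smul_apply, of_apply, mul_apply, replicateCol_apply,
      replicateRow_apply, smul_eq_mul, Finset.univ_unique, Finset.sum_singleton]
    field_simp
  rw [h, det_smul, det_one_add_replicateCol_mul_replicateRow]
  simp [dotProduct]

theorem posDef_smul_one_add_smul_ones (n : ℕ) (a b : ℝ) (ha : 0 < a) (hab : 0 < a + n * b) :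
    (a • (1 : Matrix (Fin n) (Fin n) ℝ) + b • Matrix.of (fun _ _ => (1 : ℝ))).PosDef := by
  refine PosDef.of_dotProduct_mulVec_pos ?_ fun x hx => ?_
  · ext i j
    simp [one_apply, eq_comm]
  have hq : star x ⬝ᵥ ((a • (1 : Matrix (Fin n) (Fin n) ℝ) + b • Matrix.of (fun _ _ => (1 : ℝ)))
      *ᵥ x) = a * ∑ i, x i ^ 2 + b * (∑ i, x i) ^ 2 := by
    rw [add_mulVec, smul_mulVec, smul_mulVec, one_mulVec, dotProduct_add, dotProduct_smul,
      dotProduct_smul]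
    simp only [dotProduct, mulVec, of_apply, one_mul, star_trivial, smul_eq_mul, sq,
      Finset.sum_mul]
  rw [hq]
  have hpos : 0 < ∑ i, x i ^ 2 := by
    obtain ⟨i, hi⟩ := Function.ne_iff.mp hx
    exact Finset.sum_pos' (fun i _ => sq_nonneg _) ⟨i, Finset.mem_univ i, by
      have : x i ≠ 0 := hi
      positivity⟩
  have hcs : (∑ i, x i) ^ 2 ≤ n * ∑ i, x i ^ 2 := by
    simpa using sq_sum_le_card_mul_sum_sq (s := Finset.univ) (f := x)
  rcases le_total 0 b with hb | hb
  · positivity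
  · nlinarith [mul_pos hab hpos, mul_le_mul_of_nonpos_left hcs hb]

theorem Matrix.PosSemidef.det_le_exp_trace_sub_card {n : Type*} [Fintype n] [DecidableEq n]
    {M : Matrix n n ℝ} (hM : M.PosSemidef) : M.det ≤ Real.exp (M.trace - Fintype.card n) := by
  rw [hM.isHermitian.det_eq_prod_eigenvalues, hM.isHermitian.trace_eq_sum_eigenvalues]
  have hsum : (∑ i, (hM.isHermitian.eigenvalues i : ℝ)) - Fintype.card n
      = ∑ i, (hM.isHermitian.eigenvalues i - 1) := by simp
  simp only [RCLike.ofReal_real_eq_id, id]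
  rw [hsum, Real.exp_sum]
  refine Finset.prod_le_prod (fun i _ => hM.eigenvalues_nonneg i) fun i _ => ?_
  linarith [Real.add_one_le_exp (hM.isHermitian.eigenvalues i - 1)]

open scoped MatrixOrder Matrix.Norms.L2Operator in
theorem Matrix.PosSemidef.det_mul_det_le_one {n : Type*} [Fintype n] [DecidableEq n]
    {A M : Matrix n n ℝ} (hA : A.PosSemidef) (hM : M.PosSemidef)
    (h : (A * M).trace ≤ Fintype.card n) : A.det * M.det ≤ 1 := by
  obtain ⟨L, rfl⟩ := CStarAlgebra.nonneg_iff_eq_star_mul_self.mp hM.nonneg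
  have hP : (L * A * Lᴴ).PosSemidef := hA.mul_mul_conjTranspose_same L
  have hle := hP.det_le_exp_trace_sub_card
  have hdet : (L * A * Lᴴ).det = A.det * (star L * L).det := by
    rw [star_eq_conjTranspose, det_mul, det_mul, det_mul]; ring
  have htr : (L * A * Lᴴ).trace = (A * (star L * L)).trace := by
    rw [star_eq_conjTranspose, Matrix.mul_assoc, trace_mul_comm, Matrix.mul_assoc]
  rw [hdet, htr] at hle
  exact hle.trans (Real.exp_le_one_iff.mpr (by linarith))

theorem m1_pos {K : ℕ} (hK : 1 ≤ K) : 0 < m1 K := by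
  have : (0 : ℝ) < K := by exact_mod_cast hK
  unfold m1; positivity

theorem m1_add_mul_m2 (K : ℕ) : m1 K + K * m2 K = K / ((K : ℝ) + 1) := by
  unfold m1 m2; ring

theorem m1_sq (K : ℕ) : m1 K ^ 2 = (K : ℝ) ^ 2 / ((K : ℝ) + 1) := by
  rw [m1, div_pow, Real.sq_sqrt (by positivity)]

theorem chipB_posDef {K : ℕ} (hK : 1 ≤ K) : (chipB K).PosDef := by
  have : (0 : ℝ) < K := by exact_mod_cast hK
  refine posDef_smul_one_add_smul_ones K _ _ (m1_pos hK) ?_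
  rw [m1_add_mul_m2]; positivity

theorem chipB_det {K : ℕ} (hK : 1 ≤ K) :
    (chipB K).det = (K : ℝ) ^ K / ((K : ℝ) + 1) ^ (((K : ℝ) + 1) / 2) := by
  have hK0 : (0 : ℝ) < K := by exact_mod_cast hK
  have hm := m1_pos hK
  have h1 : (0 : ℝ) < (K : ℝ) + 1 := by positivity
  have hs : 0 < Real.sqrt ((K : ℝ) + 1) := by positivity
  have hpow : ((K : ℝ) + 1) ^ (((K : ℝ) + 1) / 2) = Real.sqrt ((K : ℝ) + 1) ^ (K + 1) := by
    rw [Real.sqrt_eq_rpow, ← Real.rpow_natCast, ← Real.rpow_mul h1.le]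
    push_cast
    ring_nf
  have h2 : 1 + K * (m2 K / m1 K) = 1 / Real.sqrt ((K : ℝ) + 1) := by
    have : 1 + K * (m2 K / m1 K) = (m1 K + K * m2 K) / m1 K := by field_simp
    rw [this, m1_add_mul_m2, m1]
    field_simp
    exact Real.sq_sqrt h1.le
  rw [chipB, det_smul_one_add_smul_ones K _ _ hm.ne', h2, hpow, m1, div_pow, pow_succ]
  field_simp

theorem sum_sq_chipB_col {K : ℕ} (hK : 1 ≤ K) (j : Fin K) :
    ∑ i, chipB K i j ^ 2 = (K * m3 K) ^ 2 := by
  have hK0 : (0 : ℝ) < K := by exact_mod_cast hK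
  have h : ∑ i, chipB K i j ^ 2 = m1 K ^ 2 + 2 * m1 K * m2 K + K * m2 K ^ 2 := by
    have : ∀ i, chipB K i j ^ 2
        = (if i = j then m1 K ^ 2 + 2 * m1 K * m2 K else 0) + m2 K ^ 2 := by
      intro i
      by_cases hij : i = j <;> simp [chipB, one_apply, hij]
      ring
    simp [this, Finset.sum_add_distrib]
  have h2 : K * (m1 K ^ 2 + 2 * m1 K * m2 K + K * m2 K ^ 2)
      = (m1 K + K * m2 K) ^ 2 + (K - 1) * m1 K ^ 2 := by ring
  rw [m1_add_mul_m2] at h2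
  rw [h, m3, mul_pow, div_pow, Real.sq_sqrt hK0.le]
  apply mul_left_cancel₀ hK0.ne'
  rw [h2, m1_sq]
  field_simp
  ring

theorem chipB_mulVec_one (K : ℕ) (i : Fin K) :
    (chipB K *ᵥ fun _ => 1) i = K / ((K : ℝ) + 1) := by
  rw [← m1_add_mul_m2]
  simp [chipB, mulVec, dotProduct, Finset.sum_add_distrib, one_apply]

theorem dotProduct_self_mulVec_chipS_upper (K : ℕ) (M : Matrix (Fin K) (Fin K) ℝ) (j : Fin K) :
    (M *ᵥ chipS K (Sum.inl (Sum.inl j))) ⬝ᵥ (M *ᵥ chipS K (Sum.inl (Sum.inl j)))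
      = ∑ i, M i j ^ 2 := by
  simp [chipS, mulVec, dotProduct, sq]

theorem dotProduct_self_mulVec_chipS_lower (K : ℕ) (M : Matrix (Fin K) (Fin K) ℝ) (j : Fin K) :
    (M *ᵥ chipS K (Sum.inl (Sum.inr j))) ⬝ᵥ (M *ᵥ chipS K (Sum.inl (Sum.inr j)))
      = ∑ i, M i j ^ 2 := by
  simp [chipS, mulVec, dotProduct, sq]

theorem dotProduct_self_mulVec_chipS_sum (K : ℕ) (M : Matrix (Fin K) (Fin K) ℝ) (u : Unit) :
    (M *ᵥ chipS K (Sum.inr u)) ⬝ᵥ (M *ᵥ chipS K (Sum.inr u))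
      = ∑ i, (∑ j, M i j) ^ 2 := by
  simp [chipS, mulVec, dotProduct, sq]

theorem chipB_feasible {K : ℕ} (hK : 1 ≤ K) : smvieFeasible K (chipB K) (chipd K) := by
  have hK0 : (0 : ℝ) < K := by exact_mod_cast hK
  have h3 : 0 ≤ m3 K := by unfold m3; positivity
  have hr : Real.sqrt K ^ 2 = K := Real.sq_sqrt hK0.le
  refine ⟨chipB_posDef hK, ?_⟩
  rintro ((j | j) | u)
  · rw [dotProduct_self_mulVec_chipS_upper, sum_sq_chipB_col hK, Real.sqrt_sq (by positivity)]
    have h : m3 K + m3 K ≤ 1 := by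
      rw [m3, ← add_div, div_le_one (by positivity)]
      nlinarith [sq_nonneg (Real.sqrt K - 1)]
    have hd : chipS K (Sum.inl (Sum.inl j)) ⬝ᵥ chipd K = m3 K := by
      simp [chipS, chipd, dotProduct]
    rw [hd]
    simp only [chipt, Sum.elim_inl]
    nlinarith
  · rw [dotProduct_self_mulVec_chipS_lower, sum_sq_chipB_col hK, Real.sqrt_sq (by positivity)]
    have hd : chipS K (Sum.inl (Sum.inr j)) ⬝ᵥ chipd K = -m3 K := by
      simp [chipS, chipd, dotProduct]
    rw [hd]
    simp [chipt]
  · have hd : chipS K (Sum.inr u) ⬝ᵥ chipd K = K * m3 K := by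
      simp [chipS, chipd, dotProduct]
    have hrow : ∀ i, ∑ j, chipB K i j = K / ((K : ℝ) + 1) := fun i => by
      simpa [mulVec, dotProduct] using chipB_mulVec_one K i
    have hsq : ∑ i, (∑ j, chipB K i j) ^ 2 = (K * m3 K) ^ 2 := by
      simp only [hrow, Finset.sum_const, Finset.card_univ, Fintype.card_fin, nsmul_eq_mul]
      rw [m3, mul_pow, div_pow, div_pow, hr]
      ring
    rw [dotProduct_self_mulVec_chipS_sum, hd, hsq,
      Real.sqrt_sq (by positivity)]
    simp only [chipt, Sum.elim_inr]
    apply le_of_eq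
    rw [m3]
    field_simp
    ring

/-- The explicit inverse of `chipB K`. -/
def chipBInv (K : ℕ) : Matrix (Fin K) (Fin K) ℝ :=
  (((K : ℝ) + 1) / K ^ 2 * m1 K) • (1 : Matrix (Fin K) (Fin K) ℝ)
    + (((K : ℝ) + 1) / K ^ 2 * m2 K + 1 / K) • Matrix.of (fun _ _ => (1 : ℝ))

theorem chipBInv_posDef {K : ℕ} (hK : 1 ≤ K) : (chipBInv K).PosDef := by
  have hK0 : (0 : ℝ) < K := by exact_mod_cast hK
  have hm := m1_pos hK
  refine posDef_smul_one_add_smul_ones K _ _ (by positivity) ?_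
  have h : ((K : ℝ) + 1) / K ^ 2 * m1 K + K * (((K : ℝ) + 1) / K ^ 2 * m2 K + 1 / K)
      = ((K : ℝ) + 1) / K ^ 2 * (m1 K + K * m2 K) + 1 := by
    field_simp
    ring
  rw [h, m1_add_mul_m2]
  positivity

theorem chipBInv_mul_chipB {K : ℕ} (hK : 1 ≤ K) : chipBInv K * chipB K = 1 := by
  have hK0 : (0 : ℝ) < K := by exact_mod_cast hK
  have hJ : (Matrix.of (fun _ _ => (1 : ℝ)) : Matrix (Fin K) (Fin K) ℝ)
      * Matrix.of (fun _ _ => (1 : ℝ)) = (K : ℝ) • Matrix.of (fun _ _ => (1 : ℝ)) := by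
    ext i j; simp [mul_apply]
  have h1 : ((K : ℝ) + 1) / K ^ 2 * m1 K * m1 K = 1 := by
    rw [mul_assoc, ← sq, m1_sq]; field_simp
  have h2 : ((K : ℝ) + 1) / K ^ 2 * m1 K * m2 K
      + (((K : ℝ) + 1) / K ^ 2 * m2 K + 1 / K) * (m1 K + K * m2 K) = 0 := by
    have h3 : K * (((K : ℝ) + 1) / K ^ 2 * m1 K * m2 K
      + (((K : ℝ) + 1) / K ^ 2 * m2 K + 1 / K) * (m1 K + K * m2 K))
      = ((K : ℝ) + 1) / K ^ 2 * (m1 K + K * m2 K) ^ 2 + (m1 K + K * m2 K)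
        - ((K : ℝ) + 1) / K ^ 2 * m1 K * m1 K := by
      field_simp
      ring
    rw [h1, m1_add_mul_m2] at h3
    rw [m1_add_mul_m2]
    apply mul_left_cancel₀ hK0.ne'
    rw [h3]
    field_simp
    ring
  have hprod : ∀ a b c d : ℝ, (a • (1 : Matrix (Fin K) (Fin K) ℝ)
      + b • Matrix.of (fun _ _ => (1 : ℝ))) * (c • (1 : Matrix (Fin K) (Fin K) ℝ)
      + d • Matrix.of (fun _ _ => (1 : ℝ))) = (a * c) • (1 : Matrix (Fin K) (Fin K) ℝ)
      + (a * d + b * (c + K * d)) • Matrix.of (fun _ _ => (1 : ℝ)) := by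
    intro a b c d
    simp only [Matrix.add_mul, Matrix.mul_add, smul_mul_assoc, mul_smul_comm, Matrix.one_mul,
      Matrix.mul_one, hJ]
    module
  rw [chipBInv, chipB, hprod, h1, h2]
  simp

theorem trace_smul_one_add_smul_ones_mul (n : ℕ) (a b : ℝ) (M : Matrix (Fin n) (Fin n) ℝ) :
    ((a • (1 : Matrix (Fin n) (Fin n) ℝ) + b • Matrix.of (fun _ _ => (1 : ℝ))) * M).trace
      = a * M.trace + b * ∑ i, ∑ j, M i j := by
  rw [Matrix.add_mul, smul_mul_assoc, smul_mul_assoc, Matrix.one_mul, trace_add, trace_smul,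
    trace_smul]
  simp only [smul_eq_mul, trace, diag_apply, mul_apply, of_apply, one_mul]
  rw [Finset.sum_comm]

theorem trace_chipBInv_mul_le {K : ℕ} (hK : 1 ≤ K) {M : Matrix (Fin K) (Fin K) ℝ}
    {d : Fin K → ℝ} (h : smvieFeasible K M d) : (chipBInv K * M).trace ≤ K := by
  have hK0 : (0 : ℝ) < K := by exact_mod_cast hK
  have h3 : 0 ≤ m3 K := by unfold m3; positivity
  have hr : Real.sqrt K ^ 2 = K := Real.sq_sqrt hK0.le
  obtain ⟨-, hfeas⟩ := h
  have hcol : ∀ j, Real.sqrt (∑ i, M i j ^ 2) ≤ K * d j := fun j => by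
    have := hfeas (Sum.inl (Sum.inr j))
    rw [dotProduct_self_mulVec_chipS_lower] at this
    have hd : chipS K (Sum.inl (Sum.inr j)) ⬝ᵥ d = -d j := by
      simp [chipS, dotProduct]
    rw [hd] at this
    simp only [chipt, Sum.elim_inl, Sum.elim_inr, mul_zero] at this
    linarith
  have hsum : Real.sqrt (∑ i, (∑ j, M i j) ^ 2) + K * ∑ j, d j ≤ K * Real.sqrt K := by
    have := hfeas (Sum.inr ())
    rw [dotProduct_self_mulVec_chipS_sum] at this
    simpa [chipS, dotProduct, chipt] using this
  have hE : ∑ i, ∑ j, M i j ≤ Real.sqrt K * Real.sqrt (∑ i, (∑ j, M i j) ^ 2) := by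
    simpa using Real.sum_mul_le_sqrt_mul_sqrt Finset.univ (fun _ : Fin K => (1 : ℝ))
      (fun i => ∑ j, M i j)
  have hT : m1 K * M.trace + m2 K * ∑ i, ∑ j, M i j ≤ (K * m3 K) * (K * ∑ j, d j) := by
    have hle : ∀ j, ∑ i, chipB K i j * M i j ≤ (K * m3 K) * (K * d j) := fun j => by
      refine (Real.sum_mul_le_sqrt_mul_sqrt Finset.univ (fun i => chipB K i j)
        (fun i => M i j)).trans ?_
      rw [sum_sq_chipB_col hK, Real.sqrt_sq (by positivity)]
      exact mul_le_mul_of_nonneg_left (hcol j) (by positivity)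
    have hs := Finset.sum_le_sum fun j (_ : j ∈ Finset.univ) => hle j
    rw [← Finset.mul_sum, ← Finset.mul_sum] at hs
    refine le_of_eq_of_le ?_ hs
    simp only [chipB, Matrix.add_apply, Matrix.smul_apply, of_apply, smul_eq_mul, mul_one, add_mul,
      Finset.sum_add_distrib, one_apply, mul_ite, ite_mul, mul_zero, zero_mul,
      Finset.sum_ite_eq', Finset.mem_univ, if_true, trace, diag_apply, ← Finset.mul_sum]
    rw [Finset.sum_comm]
  rw [chipBInv, trace_smul_one_add_smul_ones_mul]
  set E := ∑ i, ∑ j, M i j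
  set s := ∑ j, d j
  have hE' : E ≤ K * (K - Real.sqrt K * s) := by
    have := mul_le_mul_of_nonneg_left hsum (Real.sqrt_nonneg K)
    nlinarith
  have hm3 : ((K : ℝ) + 1) / K ^ 2 * ((K * m3 K) * (K * s)) = Real.sqrt K * s := by
    rw [m3]; field_simp
  have hT' := mul_le_mul_of_nonneg_left hT (show 0 ≤ ((K : ℝ) + 1) / K ^ 2 by positivity)
  rw [hm3] at hT'
  have hE'' : 1 / K * E ≤ K - Real.sqrt K * s := by
    rw [one_div, inv_mul_le_iff₀ hK0]; exact hE'
  linarith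

theorem det_le_of_smvieFeasible {K : ℕ} (hK : 1 ≤ K) {M : Matrix (Fin K) (Fin K) ℝ}
    {d : Fin K → ℝ} (h : smvieFeasible K M d) : M.det ≤ (chipB K).det := by
  have h1 := (chipBInv_posDef hK).posSemidef.det_mul_det_le_one h.1.posSemidef
    (by simpa using trace_chipBInv_mul_le hK h)
  have h2 : (chipBInv K).det * (chipB K).det = 1 := by
    rw [← det_mul, chipBInv_mul_chipB hK, det_one]
  exact le_of_mul_le_mul_left (h1.trans h2.ge) (chipBInv_posDef hK).det_pos

theorem tendsto_chipB_det_rpow_div_sqrt :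
    Tendsto (fun n : ℕ => (chipB n).det ^ ((1 : ℝ) / (n : ℝ)) / Real.sqrt n)
      atTop (nhds 1) := by
  have h1 : Tendsto (fun n : ℕ => ((n : ℝ) + 1) ^ ((1 : ℝ) / (2 * ((n : ℝ) + 1) + -2)))
      atTop (nhds 1) :=
    (tendsto_rpow_div_mul_add 1 2 (-2) (by norm_num)).comp
      (tendsto_atTop_add_const_right _ 1 tendsto_natCast_atTop_atTop)
  have h2 : Tendsto (fun n : ℕ => Real.sqrt ((n : ℝ) / ((n : ℝ) + 1))) atTop (nhds 1) := by
    simpa using (tendsto_natCast_div_add_atTop (1 : ℝ)).sqrt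
  have h3 := h2.div h1 one_ne_zero
  rw [div_one] at h3
  refine h3.congr' ?_
  filter_upwards [eventually_ge_atTop 1] with n hn
  have hn0 : (0 : ℝ) < n := by exact_mod_cast hn
  have hp : (0 : ℝ) < (n : ℝ) + 1 := by positivity
  have hr : Real.sqrt n * Real.sqrt n = n := Real.mul_self_sqrt hn0.le
  have he : ((n : ℝ) + 1) / 2 * (1 / n) = 1 / 2 + 1 / (2 * ((n : ℝ) + 1) + -2) := by
    have : 2 * ((n : ℝ) + 1) + -2 = 2 * n := by ring
    rw [this]; field_simp
  simp only [Pi.div_apply]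
  rw [chipB_det hn, Real.div_rpow (by positivity) (by positivity), ← Real.rpow_natCast,
    ← Real.rpow_mul hn0.le, ← Real.rpow_mul hp.le, mul_one_div_cancel hn0.ne', Real.rpow_one, he,
    Real.rpow_add hp, ← Real.sqrt_eq_rpow, Real.sqrt_div hn0.le]
  have : 0 < Real.sqrt n := Real.sqrt_pos.mpr hn0
  have : 0 < Real.sqrt ((n : ℝ) + 1) := Real.sqrt_pos.mpr hp
  have : 0 < ((n : ℝ) + 1) ^ ((1 : ℝ) / (2 * ((n : ℝ) + 1) + -2)) := Real.rpow_pos_of_pos hp _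
  generalize ((n : ℝ) + 1) ^ ((1 : ℝ) / (2 * ((n : ℝ) + 1) + -2)) = q at *
  rw [div_div, div_div, div_eq_div_iff (by positivity) (by positivity)]
  linear_combination (Real.sqrt ((n : ℝ) + 1) * q) * hr

/-- The explicit pair `(B, d)` is optimal for the scaled MVIE problem on the chipped
hypercube, with `det B = K^K/(K+1)^{(K+1)/2}`, and `(det B)^{1/K}/√K → 1`. -/
theorem stmt_16 (K : ℕ) (hK : 2 ≤ K) :
    ((chipB K).PosDef ∧ smvieFeasible K (chipB K) (chipd K)) ∧
    (chipB K).det = (K : ℝ) ^ K / ((K : ℝ) + 1) ^ (((K : ℝ) + 1) / 2) ∧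
    (∀ (B' : Matrix (Fin K) (Fin K) ℝ) (d' : Fin K → ℝ), smvieFeasible K B' d' →
      B'.det ≤ (K : ℝ) ^ K / ((K : ℝ) + 1) ^ (((K : ℝ) + 1) / 2)) ∧
    Tendsto (fun n : ℕ => (chipB n).det ^ ((1 : ℝ) / (n : ℝ)) / Real.sqrt n)
      atTop (nhds 1) := by
  have hK1 : 1 ≤ K := by omega
  exact ⟨⟨chipB_posDef hK1, chipB_feasible hK1⟩, chipB_det hK1,
    fun _ _ h => (det_le_of_smvieFeasible hK1 h).trans_eq (chipB_det hK1),
    tendsto_chipB_det_rpow_div_sqrt⟩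
end
end
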